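/- arXiv:1301.1707 — 3 statements merged into one kernel-verified Lean document; each statement's English description precedes it below -/
import Mathlib

section
/- Let n ≥ 2 be an integer with χ_n > c², let t_1 < … < t_n be the zeros of ψ_n in (−1,1), and let θ : (−1,1) → ℝ solve θ'(t) = f(t) + v(t)·sin(2θ(t)) with θ(t_1) = π/2. Then: (i) θ extends continuously to [−1,1] with θ(−1) = 0, θ(0) = πn/2 and θ(1) = πn; (ii) θ(t_i) = (i − 1/2)·π for every i = 1,…,n; (iii) θ'(t) > 0 for all t in (−1,1); and (iv) for every t in (−1,1) with ψ_n(t) ≠ 0, θ(t) = arctan(−√((1−t²)/(χ_n−c²t²)) · ψ_n'(t)/ψ_n(t)) + m(t)·π, where m(t) is the number of zeros of ψ_n in the interval (−1, t). -/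
open Real MeasureTheory Set

/-- A `k`-th prolate datum for band limit `c`: `ψ` is real-analytic with unit
`L²[-1,1]` norm, has exactly `k` zeros in `(-1,1)`, is an eigenfunction of the
prolate integral operator with nonzero eigenvalue `lam`, and satisfies the
prolate differential equation with eigenvalue `χ`. -/
structure ProlateDatum (c : ℝ) (k : ℕ) (ψ : ℝ → ℝ) (lam : ℂ) (χ : ℝ) : Prop where
  analytic : ∀ x : ℝ, AnalyticAt ℝ ψ x
  normalized : ∫ t in (-1:ℝ)..1, (ψ t)^2 = 1
  zeros_card : {x : ℝ | x ∈ Set.Ioo (-1:ℝ) 1 ∧ ψ x = 0}.encard = k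
  lam_ne_zero : lam ≠ 0
  integral_eig : ∀ x : ℝ,
    lam * (ψ x : ℂ) =
      ∫ t in (-1:ℝ)..1, (ψ t : ℂ) * Complex.exp (Complex.I * (c:ℂ) * (x:ℂ) * (t:ℂ))
  diff_eq : ∀ x : ℝ,
    (1 - x^2) * deriv (deriv ψ) x - 2*x * deriv ψ x + (χ - c^2 * x^2) * ψ x = 0

/-- The function `f(t) = √((χ − c²t²)/(1 − t²))` of the Prüfer transformation. -/
noncomputable def pruferF (c χ t : ℝ) : ℝ := Real.sqrt ((χ - c^2*t^2) / (1 - t^2))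

/-- The function `v(t) = (1/2)·(t/(1−t²) + c²t/(χ − c²t²))` of the Prüfer
transformation. -/
noncomputable def pruferV (c χ t : ℝ) : ℝ :=
  (1/2) * (t/(1-t^2) + c^2*t/(χ - c^2*t^2))

/-- antiderivative of a continuous function on `(-1,1)` -/
lemma pr_antideriv (a : ℝ → ℝ) (ha : ContinuousOn a (Ioo (-1:ℝ) 1)) :
    ∃ A : ℝ → ℝ, ∀ x ∈ Ioo (-1:ℝ) 1, HasDerivAt A (a x) x := by
  refine ⟨fun x => ∫ s in (0:ℝ)..x, a s, fun x hx => ?_⟩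
  have hsub : uIcc (0:ℝ) x ⊆ Ioo (-1:ℝ) 1 := by
    intro y hy
    rw [mem_uIcc] at hy
    obtain ⟨h1, h2⟩ := hx
    constructor <;> rcases hy with h | h <;> linarith [h.1, h.2]
  refine intervalIntegral.integral_hasDerivAt_right
    ((ha.mono hsub).intervalIntegrable) ?_ (ha.continuousAt (isOpen_Ioo.mem_nhds hx))
  exact ha.stronglyMeasurableAtFilter isOpen_Ioo x hx

lemma pr_linear_zero (a u : ℝ → ℝ) (ha : ContinuousOn a (Ioo (-1:ℝ) 1))
    (hu : ∀ x ∈ Ioo (-1:ℝ) 1, HasDerivAt u (a x * u x) x)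
    (x0 : ℝ) (hx0 : x0 ∈ Ioo (-1:ℝ) 1) (h0 : u x0 = 0) :
    ∀ x ∈ Ioo (-1:ℝ) 1, u x = 0 := by
  obtain ⟨A, hA⟩ := pr_antideriv a ha
  have hd : ∀ x ∈ Ioo (-1:ℝ) 1, HasDerivAt (fun y => u y * Real.exp (-A y)) 0 x := by
    intro x hx
    have := (hu x hx).mul ((hA x hx).neg.exp)
    refine this.congr_deriv ?_
    simp only [Pi.neg_apply]
    ring
  intro x hx
  have hc := isOpen_Ioo.is_const_of_deriv_eq_zero (isPreconnected_Ioo)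
    (f := fun y => u y * Real.exp (-A y))
    (fun y hy => (hd y hy).differentiableAt.differentiableWithinAt)
    (fun y hy => (hd y hy).deriv) hx hx0
  simp only [h0, zero_mul] at hc
  exact (mul_eq_zero.1 hc).resolve_right (Real.exp_pos _).ne'

lemma pr_linear_nonpos (a h h' : ℝ → ℝ) (ha : ContinuousOn a (Ioo (-1:ℝ) 1))
    (hh : ∀ x ∈ Ioo (0:ℝ) 1, HasDerivAt h (h' x) x)
    (hle : ∀ x ∈ Ioo (0:ℝ) 1, h' x ≤ a x * h x)
    (x0 : ℝ) (hx0 : x0 ∈ Ioo (0:ℝ) 1) (h0 : h x0 ≤ 0) :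
    ∀ x ∈ Ioo (0:ℝ) 1, x0 ≤ x → h x ≤ 0 := by
  obtain ⟨A, hA⟩ := pr_antideriv a ha
  have hd : ∀ x ∈ Ioo (0:ℝ) 1, HasDerivAt (fun y => h y * Real.exp (-A y))
      ((h' x - a x * h x) * Real.exp (-A x)) x := by
    intro x hx
    have := (hh x hx).mul ((hA x ⟨by linarith [hx.1], hx.2⟩).neg.exp)
    refine this.congr_deriv ?_
    simp only [Pi.neg_apply]
    ring
  have hanti : AntitoneOn (fun y => h y * Real.exp (-A y)) (Ioo (0:ℝ) 1) := by
    refine antitoneOn_of_deriv_nonpos (convex_Ioo _ _)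
      (fun y hy => (hd y hy).continuousAt.continuousWithinAt) ?_ ?_
    · rw [interior_Ioo]
      exact fun y hy => (hd y hy).differentiableAt.differentiableWithinAt
    · rw [interior_Ioo]
      intro y hy
      rw [(hd y hy).deriv]
      exact mul_nonpos_of_nonpos_of_nonneg (by linarith [hle y hy]) (Real.exp_pos _).le
  intro x hx hxx
  have h1 := hanti hx0 hx hxx
  have h2 : h x0 * Real.exp (-A x0) ≤ 0 := mul_nonpos_of_nonpos_of_nonneg h0 (Real.exp_pos _).le
  by_contra hcon
  push Not at hcon
  have := mul_pos hcon (Real.exp_pos (-A x))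
  linarith

lemma pr_polar (f v ψ w θ : ℝ → ℝ)
    (hv : ContinuousOn v (Ioo (-1:ℝ) 1))
    (hψ : ∀ x ∈ Ioo (-1:ℝ) 1, HasDerivAt ψ (f x * w x) x)
    (hw : ∀ x ∈ Ioo (-1:ℝ) 1, HasDerivAt w (-f x * ψ x + 2 * v x * w x) x)
    (hθ : ∀ x ∈ Ioo (-1:ℝ) 1, HasDerivAt θ (f x + v x * Real.sin (2 * θ x)) x)
    (x0 : ℝ) (hx0 : x0 ∈ Ioo (-1:ℝ) 1) (h0 : ψ x0 = 0) (h1 : θ x0 = π / 2)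
    (x1 : ℝ) (hx1 : x1 ∈ Ioo (-1:ℝ) 1) (hne : ψ x1 ≠ 0) :
    ∃ ρ : ℝ → ℝ, ∀ x ∈ Ioo (-1:ℝ) 1, ρ x ≠ 0 ∧ ψ x = ρ x * Real.cos (θ x) ∧
      w x = - ρ x * Real.sin (θ x) := by
  have hθc : ContinuousOn θ (Ioo (-1:ℝ) 1) :=
    fun x hx => (hθ x hx).continuousAt.continuousWithinAt
  have hD := pr_linear_zero (fun x => 2 * v x * (Real.cos (θ x))^2)
    (fun x => ψ x * Real.sin (θ x) + w x * Real.cos (θ x)) (by fun_prop) (by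
      intro x hx
      have := ((hψ x hx).mul (hθ x hx).sin).add ((hw x hx).mul (hθ x hx).cos)
      refine this.congr_deriv ?_
      rw [Real.sin_two_mul]
      have := Real.sin_sq_add_cos_sq (θ x)
      linear_combination (-2 * v x * w x * Real.cos (θ x)) * this) x0 hx0 (by
      simp [h0, h1])
  have key : ∀ x ∈ Ioo (-1:ℝ) 1, ψ x = (ψ x * Real.cos (θ x) - w x * Real.sin (θ x)) * Real.cos (θ x) ∧
      w x = - (ψ x * Real.cos (θ x) - w x * Real.sin (θ x)) * Real.sin (θ x) := by
    intro x hx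
    have h2 := hD x hx
    have := Real.sin_sq_add_cos_sq (θ x)
    constructor
    · linear_combination (-ψ x) * this + Real.sin (θ x) * h2
    · linear_combination (-w x) * this + Real.cos (θ x) * h2
  refine ⟨fun x => ψ x * Real.cos (θ x) - w x * Real.sin (θ x), fun x hx => ⟨?_, key x hx⟩⟩
  intro hz
  have hR := pr_linear_zero (fun x => 2 * v x * (Real.sin (θ x))^2)
    (fun x => ψ x * Real.cos (θ x) - w x * Real.sin (θ x)) (by fun_prop) (by
      intro x hx
      have := ((hψ x hx).mul (hθ x hx).cos).sub ((hw x hx).mul (hθ x hx).sin)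
      refine this.congr_deriv ?_
      have h2 := hD x hx
      have h3 := (key x hx).2
      linear_combination (f x - (f x + v x * Real.sin (2 * θ x))) * h2
        - 2 * v x * Real.sin (θ x) * h3) x hx hz
  have := hR x1 hx1
  rw [(key x1 hx1).1, this, zero_mul] at hne
  exact hne rfl

lemma pr_barrier (g g' : ℝ → ℝ) (L : ℝ)
    (hg : ∀ x ∈ Ioo (-1:ℝ) 1, HasDerivAt g (g' x) x)
    (hpos : ∀ x ∈ Ioo (-1:ℝ) 1, g x = L → 0 < g' x)
    (x y : ℝ) (hx : x ∈ Ioo (-1:ℝ) 1) (hy : y ∈ Ioo (-1:ℝ) 1) (hxy : x < y) (hL : L ≤ g x) :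
    L < g y := by
  have hsub : Icc x y ⊆ Ioo (-1:ℝ) 1 := fun z hz => ⟨by linarith [hz.1, hx.1], by linarith [hz.2, hy.2]⟩
  have hle : ∀ z ∈ Icc x y, L ≤ g z := by
    intro z hz
    exact image_le_of_deriv_right_lt_deriv_boundary' (f := fun _ => L) (f' := fun _ => 0)
      (B := g) (B' := g') continuousOn_const
      (fun z hz => (hasDerivAt_const z L).hasDerivWithinAt) hL
      (fun z hz => (hg z (hsub hz)).continuousAt.continuousWithinAt)
      (fun z hz => (hg z (hsub ⟨hz.1, hz.2.le⟩)).hasDerivWithinAt)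
      (fun z hz h => hpos z (hsub ⟨hz.1, hz.2.le⟩) h.symm) hz
  rcases (hle y ⟨hxy.le, le_rfl⟩).lt_or_eq with h | h
  · exact h
  · exfalso
    have hp := hpos y hy h.symm
    have hs := (hasDerivAt_iff_tendsto_slope.1 (hg y hy)).eventually (lt_mem_nhds hp)
    have hs2 : ∀ᶠ z in nhdsWithin y (Iio y), 0 < slope g y z :=
      hs.filter_mono (nhdsWithin_mono _ (fun z hz => ne_of_lt hz))
    obtain ⟨z, hz1, hz2⟩ := (hs2.and (Ioo_mem_nhdsLT hxy)).exists
    rw [slope_def_field] at hz1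
    have h3 := hle z ⟨hz2.1.le, hz2.2.le⟩
    have h4 : (g z - g y) / (z - y) ≤ 0 :=
      div_nonpos_of_nonneg_of_nonpos (by linarith) (by linarith [hz2.2])
    linarith

lemma pr_card {n : ℕ} (t : Fin n → ℝ) (ht : StrictMono t) (x : ℝ) (j : Fin n) :
    t j < x ↔ (j : ℕ) < (Finset.univ.filter (fun j => t j < x)).card := by
  constructor
  · intro h
    have : Finset.Iic j ⊆ Finset.univ.filter (fun j => t j < x) := by
      intro k hk
      simp only [Finset.mem_Iic] at hk
      simp only [Finset.mem_filter, Finset.mem_univ, true_and]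
      exact lt_of_le_of_lt (ht.monotone hk) h
    have := Finset.card_le_card this
    rw [Fin.card_Iic] at this
    omega
  · intro h
    by_contra hcon
    have : Finset.univ.filter (fun j => t j < x) ⊆ Finset.Iio j := by
      intro k hk
      simp only [Finset.mem_filter, Finset.mem_univ, true_and] at hk
      simp only [Finset.mem_Iio]
      by_contra h3
      exact hcon (lt_of_le_of_lt (ht.monotone (not_lt.1 h3)) hk)
    have := Finset.card_le_card this
    rw [Fin.card_Iio] at this
    omega

/-- counting of levels -/
lemma pr_levels {n : ℕ} (hn : 0 < n) (t : Fin n → ℝ) (ht : StrictMono t)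
    (ht_mem : ∀ j, t j ∈ Ioo (-1:ℝ) 1) (θ θ' : ℝ → ℝ)
    (hθ : ∀ x ∈ Ioo (-1:ℝ) 1, HasDerivAt θ (θ' x) x)
    (hpos : ∀ x ∈ Ioo (-1:ℝ) 1, Real.cos (θ x) = 0 → 0 < θ' x)
    (hz : ∀ x ∈ Ioo (-1:ℝ) 1, Real.cos (θ x) = 0 ↔ ∃ j, x = t j)
    (h0 : θ (t ⟨0, hn⟩) = π / 2) :
    (∀ i : Fin n, θ (t i) = ((i : ℝ) + 1 - 1/2) * π) ∧
    (∀ x ∈ Ioo (-1:ℝ) 1, Real.cos (θ x) ≠ 0 →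
      |θ x - ((Finset.univ.filter (fun j => t j < x)).card : ℝ) * π| < π / 2) := by
  have hpi := Real.pi_pos
  have hlev : ∀ k : ℤ, ∀ y, y = (2 * (k:ℝ) + 1) * π / 2 → Real.cos y = 0 := by
    intro k y hy
    exact Real.cos_eq_zero_iff.2 ⟨k, hy⟩
  have hbar : ∀ (k : ℤ) (x y : ℝ), x ∈ Ioo (-1:ℝ) 1 → y ∈ Ioo (-1:ℝ) 1 → x < y →
      (2 * (k:ℝ) + 1) * π / 2 ≤ θ x → (2 * (k:ℝ) + 1) * π / 2 < θ y := by
    intro k x y hx hy hxy hL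
    exact pr_barrier θ θ' _ hθ (fun z hz' h => hpos z hz' (hlev k _ h)) x y hx hy hxy hL
  have hivt : ∀ (k : ℤ) (x y : ℝ), x ∈ Ioo (-1:ℝ) 1 → y ∈ Ioo (-1:ℝ) 1 → x < y →
      θ x ≤ (2 * (k:ℝ) + 1) * π / 2 → (2 * (k:ℝ) + 1) * π / 2 ≤ θ y →
      ∃ j, x ≤ t j ∧ t j ≤ y ∧ θ (t j) = (2 * (k:ℝ) + 1) * π / 2 := by
    intro k x y hx hy hxy h1 h2
    have hsub : Icc x y ⊆ Ioo (-1:ℝ) 1 :=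
      fun z hz => ⟨by linarith [hz.1, hx.1], by linarith [hz.2, hy.2]⟩
    obtain ⟨s, hs, hs2⟩ := intermediate_value_Icc hxy.le
      (fun z hz => (hθ z (hsub hz)).continuousAt.continuousWithinAt) ⟨h1, h2⟩
    obtain ⟨j, rfl⟩ := (hz s (hsub hs)).1 (hlev k _ hs2)
    exact ⟨j, hs.1, hs.2, hs2⟩
  have hA : ∀ i : ℕ, ∀ hi : i < n, θ (t ⟨i, hi⟩) = ((i : ℝ) + 1 - 1/2) * π := by
    intro i
    induction i with
    | zero => intro hi; rw [h0]; push_cast; ring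
    | succ i ih =>
      intro hi
      have hi' : i < n := by omega
      have e := ih hi'
      have hlt : t ⟨i, hi'⟩ < t ⟨i+1, hi⟩ := ht (by simp)
      obtain ⟨k, hk⟩ := Real.cos_eq_zero_iff.1 ((hz _ (ht_mem ⟨i+1, hi⟩)).2 ⟨_, rfl⟩)
      have h1 := hbar i _ _ (ht_mem ⟨i, hi'⟩) (ht_mem ⟨i+1, hi⟩) hlt (by
        rw [e]; push_cast; linarith)
      rw [hk] at h1
      have h2 : (i:ℤ) < k := by
        have : ((i:ℤ):ℝ) < (k:ℝ) := by nlinarith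
        exact_mod_cast this
      rcases (show (i:ℤ) + 1 ≤ k from h2).lt_or_eq with h3 | h3
      · exfalso
        have h3' : (i:ℝ) + 1 < (k:ℝ) := by exact_mod_cast h3
        obtain ⟨j, hj1, hj2, hj3⟩ := hivt (i+1) _ _ (ht_mem ⟨i, hi'⟩) (ht_mem ⟨i+1, hi⟩) hlt
          (by rw [e]; push_cast; nlinarith) (by rw [hk]; push_cast; nlinarith)
        have hj1' := ht.le_iff_le.1 hj1
        have hj2' := ht.le_iff_le.1 hj2
        rw [Fin.le_def] at hj1' hj2'
        simp only at hj1' hj2'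
        rcases (show (j:ℕ) = i ∨ (j:ℕ) = i + 1 by omega) with h | h
        · have : j = ⟨i, hi'⟩ := Fin.ext h
          rw [this, e] at hj3
          push_cast at hj3
          nlinarith
        · have : j = ⟨i+1, hi⟩ := Fin.ext h
          rw [this, hk] at hj3
          push_cast at hj3
          nlinarith
      · have h3' : (k:ℝ) = (i:ℝ) + 1 := by exact_mod_cast h3.symm
        rw [hk, h3']; push_cast; ring
  refine ⟨fun i => hA i i.2, fun x hx hcx => ?_⟩
  have hcard := pr_card t ht x
  set m := (Finset.univ.filter (fun j => t j < x)).card with hm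
  have hmn : m ≤ n := by
    have := Finset.card_le_univ (Finset.univ.filter (fun j => t j < x))
    simpa using this
  have hnet : ∀ j, t j ≠ x := fun j hj => hcx ((hz x hx).2 ⟨j, hj.symm⟩)
  rw [abs_lt]
  constructor
  · rcases Nat.eq_zero_or_pos m with h | h
    · by_contra hcon
      push Not at hcon
      have hx0 : x < t ⟨0, hn⟩ := by
        refine lt_of_le_of_ne (not_lt.1 fun h' => ?_) (hnet _).symm
        have := (hcard ⟨0, hn⟩).1 h'
        omega
      obtain ⟨j, hj1, hj2, hj3⟩ := hivt (-1) x _ hx (ht_mem ⟨0, hn⟩) hx0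
        (by rw [h] at hcon; push_cast at hcon ⊢; linarith) (by rw [h0]; push_cast; linarith)
      rw [hA j j.2] at hj3
      push_cast at hj3
      have : (0:ℝ) ≤ (j:ℕ) := Nat.cast_nonneg _
      nlinarith
    · have hlt := (hcard ⟨m-1, by omega⟩).2 (by simp only; omega)
      have := hbar ((m:ℤ)-1) _ x (ht_mem ⟨m-1, by omega⟩) hx hlt (by
        rw [hA (m-1) (by omega), Nat.cast_sub h]; push_cast; linarith)
      push_cast at this
      linarith
  · rcases hmn.lt_or_eq with h | h
    · have hlt : x < t ⟨m, h⟩ := by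
        refine lt_of_le_of_ne (not_lt.1 fun h' => ?_) (hnet _).symm
        have := (hcard ⟨m, h⟩).1 h'
        simp at this
      by_contra hcon
      push Not at hcon
      have := hbar m x _ hx (ht_mem ⟨m, h⟩) hlt (by push_cast; linarith)
      rw [hA m h] at this
      push_cast at this
      linarith
    · by_contra hcon
      push Not at hcon
      have hlt := (hcard ⟨n-1, by omega⟩).2 (by simp only; omega)
      obtain ⟨j, hj1, hj2, hj3⟩ := hivt n _ x (ht_mem ⟨n-1, by omega⟩) hx hlt (by
        rw [hA (n-1) (by omega), Nat.cast_sub hn]; push_cast; nlinarith)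
        (by rw [h] at hcon; push_cast; linarith)
      rw [hA j j.2] at hj3
      push_cast at hj3
      have : ((j:ℕ):ℝ) + 1 ≤ n := by exact_mod_cast j.2
      nlinarith

lemma pr_P {x : ℝ} (hx : x ∈ Ioo (-1:ℝ) 1) : 0 < 1 - x^2 := by
  nlinarith [hx.1, hx.2]

lemma pr_Q {c χ x : ℝ} (hχ : χ > c^2) (hx : x ∈ Icc (-1:ℝ) 1) : 0 < χ - c^2 * x^2 := by
  have : x^2 ≤ 1 := by nlinarith [hx.1, hx.2]
  nlinarith [sq_nonneg c]

lemma pr_fcont {c χ : ℝ} : ContinuousOn (pruferF c χ) (Ioo (-1:ℝ) 1) := by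
  unfold pruferF
  refine ContinuousOn.sqrt (ContinuousOn.div (by fun_prop) (by fun_prop) ?_)
  exact fun x hx => (pr_P hx).ne'

lemma pr_vcont {c χ : ℝ} (hχ : χ > c^2) : ContinuousOn (pruferV c χ) (Ioo (-1:ℝ) 1) := by
  unfold pruferV
  refine ContinuousOn.mul (by fun_prop) (ContinuousOn.add (ContinuousOn.div (by fun_prop) (by fun_prop) ?_)
    (ContinuousOn.div (by fun_prop) (by fun_prop) ?_))
  · exact fun x hx => (pr_P hx).ne'
  · exact fun x hx => (pr_Q hχ (Ioo_subset_Icc_self hx)).ne'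

lemma pr_fpos {c χ x : ℝ} (hχ : χ > c^2) (hx : x ∈ Ioo (-1:ℝ) 1) : 0 < pruferF c χ x :=
  Real.sqrt_pos.2 (div_pos (pr_Q hχ (Ioo_subset_Icc_self hx)) (pr_P hx))

lemma pr_vpos {c χ x : ℝ} (hc : 0 < c) (hχ : χ > c^2) (hx : x ∈ Ioo (0:ℝ) 1) : 0 < pruferV c χ x := by
  have hx' : x ∈ Ioo (-1:ℝ) 1 := ⟨by linarith [hx.1], hx.2⟩
  have h1 := pr_P hx'
  have h2 := pr_Q hχ (Ioo_subset_Icc_self hx')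
  have h3 := hx.1
  unfold pruferV
  positivity

lemma pr_feven (c χ x : ℝ) : pruferF c χ (-x) = pruferF c χ x := by
  simp [pruferF]

lemma pr_vodd (c χ x : ℝ) : pruferV c χ (-x) = - pruferV c χ x := by
  simp only [pruferV, neg_sq]; ring

/-- the scaled derivative -/
noncomputable def prW (c χ : ℝ) (ψ : ℝ → ℝ) (x : ℝ) : ℝ :=
  Real.sqrt ((1 - x^2)/(χ - c^2*x^2)) * deriv ψ x

lemma pr_gf {c χ x : ℝ} (hχ : χ > c^2) (hx : x ∈ Ioo (-1:ℝ) 1) :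
    pruferF c χ x * Real.sqrt ((1 - x^2)/(χ - c^2*x^2)) = 1 := by
  have h1 := pr_P hx
  have h2 := pr_Q hχ (Ioo_subset_Icc_self hx)
  unfold pruferF
  rw [← Real.sqrt_mul (div_pos h2 h1).le, Real.sqrt_eq_one]
  field_simp

lemma pr_wderiv {c χ x : ℝ} {ψ : ℝ → ℝ} (hχ : χ > c^2) (hx : x ∈ Ioo (-1:ℝ) 1)
    (hd : DifferentiableAt ℝ (deriv ψ) x)
    (hode : (1 - x^2) * deriv (deriv ψ) x - 2*x * deriv ψ x + (χ - c^2 * x^2) * ψ x = 0) :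
    HasDerivAt (prW c χ ψ) (-pruferF c χ x * ψ x + 2 * pruferV c χ x * prW c χ ψ x) x := by
  have h1 := pr_P hx
  have h2 := pr_Q hχ (Ioo_subset_Icc_self hx)
  have h3 : HasDerivAt (fun y : ℝ => (1 - y^2)/(χ - c^2*y^2))
      ((-(2*x) * (χ - c^2*x^2) - (1 - x^2) * (-(c^2 * (2*x))))/(χ - c^2*x^2)^2) x := by
    have ha : HasDerivAt (fun y : ℝ => 1 - y^2) (-(2*x)) x := by
      simpa using (hasDerivAt_pow 2 x).const_sub 1
    have hb : HasDerivAt (fun y : ℝ => χ - c^2*y^2) (-(c^2 * (2*x))) x := by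
      simpa using ((hasDerivAt_pow 2 x).const_mul (c^2)).const_sub χ
    exact ha.div hb h2.ne'
  have h4 := (h3.sqrt (div_pos h1 h2).ne').mul hd.hasDerivAt
  refine h4.congr_deriv ?_
  have hfg := pr_gf hχ hx
  have hgpos : 0 < Real.sqrt ((1 - x^2)/(χ - c^2*x^2)) := Real.sqrt_pos.2 (div_pos h1 h2)
  have hg2 : Real.sqrt ((1 - x^2)/(χ - c^2*x^2))^2 = (1 - x^2)/(χ - c^2*x^2) :=
    Real.sq_sqrt (div_pos h1 h2).le
  unfold prW
  set g := Real.sqrt ((1 - x^2)/(χ - c^2*x^2)) with hg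
  have hf : pruferF c χ x = g * (χ - c^2*x^2) / (1 - x^2) := by
    have : pruferF c χ x = 1 / g := by rw [eq_div_iff hgpos.ne', hfg]
    rw [this, div_eq_div_iff hgpos.ne' h1.ne']
    rw [eq_div_iff h2.ne'] at hg2
    linear_combination -hg2
  have hpp : deriv (deriv ψ) x = (2*x * deriv ψ x - (χ - c^2 * x^2) * ψ x) / (1 - x^2) := by
    rw [eq_div_iff h1.ne']; linear_combination hode
  have hq : (-(2*x) * (χ - c^2*x^2) - (1 - x^2) * (-(c^2 * (2*x))))/(χ - c^2*x^2)^2 / (2 * g)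
      = g * (-x/(1-x^2) + c^2*x/(χ - c^2*x^2)) := by
    rw [div_eq_iff (by positivity)]
    have : g * (-x/(1-x^2) + c^2*x/(χ - c^2*x^2)) * (2 * g)
      = 2 * g^2 * (-x/(1-x^2) + c^2*x/(χ - c^2*x^2)) := by ring
    rw [this, hg2]
    generalize hP : 1 - x^2 = P at *
    generalize hQ : χ - c^2*x^2 = Q at *
    field_simp
    ring
  rw [hq, hf, hpp]
  unfold pruferV
  field_simp
  ring

lemma pr_ratio {c χ : ℝ} (hc : 0 < c) (hχ : χ > c^2) :
    AntitoneOn (fun x => pruferF c χ x / pruferV c χ x) (Ioo (0:ℝ) 1) := by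
  have key : ∀ x ∈ Ioo (0:ℝ) 1, (pruferF c χ x / pruferV c χ x)^2 =
      4 * (χ - c^2*x^2)^2 / (x^2 * (4 * c^2 + (χ - c^2)^2 / ((1-x^2) * (χ - c^2*x^2)))) := by
    intro x hx
    have hx' : x ∈ Ioo (-1:ℝ) 1 := ⟨by linarith [hx.1], hx.2⟩
    have h1 := pr_P hx'
    have h2 := pr_Q hχ (Ioo_subset_Icc_self hx')
    have h3 := hx.1
    have h4 : 0 < (χ - c^2*x^2) + c^2 * (1 - x^2) := by positivity
    rw [div_pow, pruferF, Real.sq_sqrt (div_pos h2 h1).le]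
    have e1 : pruferV c χ x = x * ((χ - c^2*x^2) + c^2 * (1 - x^2)) / (2 * (1-x^2) * (χ - c^2*x^2)) := by
      unfold pruferV
      generalize hP : 1 - x^2 = P at *
      generalize hQ : χ - c^2*x^2 = Q at *
      field_simp
    have e2 : 4 * c^2 + (χ - c^2)^2 / ((1-x^2) * (χ - c^2*x^2)) =
        ((χ - c^2*x^2) + c^2 * (1 - x^2))^2 / ((1-x^2) * (χ - c^2*x^2)) := by
      field_simp
      ring
    rw [e1, e2]
    field_simp
    try ring
  intro x hx y hy hxy
  have hx' : x ∈ Ioo (-1:ℝ) 1 := ⟨by linarith [hx.1], hx.2⟩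
  have hy' : y ∈ Ioo (-1:ℝ) 1 := ⟨by linarith [hy.1], hy.2⟩
  refine abs_le_of_sq_le_sq' ?_ (div_pos (pr_fpos hχ hx') (pr_vpos hc hχ hx)).le |>.2
  rw [key x hx, key y hy]
  have h1 := pr_P hx'
  have h2 := pr_Q hχ (Ioo_subset_Icc_self hx')
  have h1' := pr_P hy'
  have h2' := pr_Q hχ (Ioo_subset_Icc_self hy')
  have h3 := hx.1
  have h4 : x^2 ≤ y^2 := by gcongr
  have h5 : c^2 * x^2 ≤ c^2 * y^2 := by gcongr
  gcongr

lemma pr_ratio_diff {c χ x : ℝ} (hc : 0 < c) (hχ : χ > c^2) (hx : x ∈ Ioo (0:ℝ) 1) :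
    DifferentiableAt ℝ (fun x => pruferF c χ x / pruferV c χ x) x := by
  have hx' : x ∈ Ioo (-1:ℝ) 1 := ⟨by linarith [hx.1], hx.2⟩
  have h1 := pr_P hx'
  have h2 := pr_Q hχ (Ioo_subset_Icc_self hx')
  have hd1 : DifferentiableAt ℝ (pruferF c χ) x := by
    unfold pruferF
    exact DifferentiableAt.sqrt (DifferentiableAt.div (by fun_prop) (by fun_prop) h1.ne')
      (div_pos h2 h1).ne'
  have hd2 : DifferentiableAt ℝ (pruferV c χ) x := by
    unfold pruferV
    exact DifferentiableAt.mul (by fun_prop)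
      (DifferentiableAt.add (DifferentiableAt.div (by fun_prop) (by fun_prop) h1.ne')
        (DifferentiableAt.div (by fun_prop) (by fun_prop) h2.ne'))
  exact hd1.div hd2 (pr_vpos hc hχ hx).ne'

lemma pr_ratio_deriv {c χ x : ℝ} (hc : 0 < c) (hχ : χ > c^2) (hx : x ∈ Ioo (0:ℝ) 1) :
    deriv (fun x => pruferF c χ x / pruferV c χ x) x ≤ 0 := by
  have := (pr_ratio hc hχ).derivWithin_nonpos (x := x)
  rwa [derivWithin_of_isOpen isOpen_Ioo hx] at this

lemma pr_wcont {c χ : ℝ} {ψ : ℝ → ℝ} (hχ : χ > c^2) (hd : Continuous (deriv ψ)) :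
    ContinuousOn (prW c χ ψ) (Icc (-1:ℝ) 1) := by
  unfold prW
  refine ContinuousOn.mul (ContinuousOn.sqrt (ContinuousOn.div (by fun_prop) (by fun_prop) ?_))
    hd.continuousOn
  exact fun x hx => (pr_Q hχ hx).ne'

lemma pr_end {c χ : ℝ} {ψ : ℝ → ℝ} (hc : 0 < c) (hχ : χ > c^2) (hψc : Continuous ψ)
    (hd : Continuous (deriv ψ))
    (hψ : ∀ x ∈ Ioo (-1:ℝ) 1, HasDerivAt ψ (pruferF c χ x * prW c χ ψ x) x)
    (hw : ∀ x ∈ Ioo (-1:ℝ) 1, HasDerivAt (prW c χ ψ)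
      (-pruferF c χ x * ψ x + 2 * pruferV c χ x * prW c χ ψ x) x)
    (x1 : ℝ) (hx1 : x1 ∈ Ioo (0:ℝ) 1) (hne : ψ x1 ≠ 0) : ψ 1 ≠ 0 := by
  have hmono : MonotoneOn (fun x => ψ x ^2 + prW c χ ψ x^2) (Icc (0:ℝ) 1) := by
    have hder : ∀ x ∈ Ioo (0:ℝ) 1, HasDerivAt (fun x => ψ x ^2 + prW c χ ψ x^2)
        (4 * pruferV c χ x * prW c χ ψ x ^2) x := by
      intro x hx
      have hx' : x ∈ Ioo (-1:ℝ) 1 := ⟨by linarith [hx.1], hx.2⟩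
      refine (((hψ x hx').pow 2).add ((hw x hx').pow 2)).congr_deriv ?_
      push_cast
      ring
    refine monotoneOn_of_deriv_nonneg (convex_Icc _ _) ?_ ?_ ?_
    · exact (hψc.continuousOn.pow 2).add (((pr_wcont hχ hd).mono
        (Icc_subset_Icc (by norm_num) le_rfl)).pow 2)
    · rw [interior_Icc]
      exact fun y hy => (hder y hy).differentiableAt.differentiableWithinAt
    · rw [interior_Icc]
      intro y hy
      rw [(hder y hy).deriv]
      have := pr_vpos hc hχ hy
      positivity
  intro h
  have := hmono (Ioo_subset_Icc_self hx1) (right_mem_Icc.2 zero_le_one) hx1.2.le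
  have hw1 : prW c χ ψ 1 = 0 := by simp [prW]
  simp only [h, hw1] at this
  have hp : 0 < ψ x1 ^2 := by positivity
  nlinarith [sq_nonneg (prW c χ ψ x1)]

/-- symmetry of the phase -/
lemma pr_symm {c χ : ℝ} {n : ℕ} (hc : 0 < c) (hχ : χ > c^2) (θ : ℝ → ℝ)
    (hθ : ∀ x ∈ Ioo (-1:ℝ) 1, HasDerivAt θ (pruferF c χ x + pruferV c χ x * Real.sin (2 * θ x)) x)
    (hl : Filter.Tendsto θ (nhdsWithin (-1) (Ioi (-1))) (nhds 0))
    (hr : Filter.Tendsto θ (nhdsWithin 1 (Iio 1)) (nhds (π * n))) :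
    ∀ x ∈ Ioo (-1:ℝ) 1, θ (-x) = n * π - θ x := by
  have hneg : ∀ x ∈ Ioo (-1:ℝ) 1, -x ∈ Ioo (-1:ℝ) 1 := fun x hx => ⟨by linarith [hx.2], by linarith [hx.1]⟩
  have hθc : ContinuousOn θ (Ioo (-1:ℝ) 1) :=
    fun x hx => (hθ x hx).continuousAt.continuousWithinAt
  have hθc' : ContinuousOn (fun x => θ (-x)) (Ioo (-1:ℝ) 1) :=
    hθc.comp (by fun_prop) hneg
  have hvc := pr_vcont hχ
  set u : ℝ → ℝ := fun x => θ x + θ (-x) - n * π with hu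
  have huc : ContinuousOn u (Ioo (-1:ℝ) 1) := (hθc.add hθc').sub continuousOn_const
  set a : ℝ → ℝ := fun x => 2 * pruferV c χ x * Real.cos (θ x - θ (-x) + n * π) * Real.sinc (u x) with ha
  have hac : ContinuousOn a (Ioo (-1:ℝ) 1) := by
    refine ((continuousOn_const.mul hvc).mul ?_).mul (Real.continuous_sinc.comp_continuousOn huc)
    exact Real.continuous_cos.comp_continuousOn ((hθc.sub hθc').add continuousOn_const)
  have hud : ∀ x ∈ Ioo (-1:ℝ) 1, HasDerivAt u (a x * u x) x := by
    intro x hx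
    have h1 := hθ x hx
    have h2 : HasDerivAt (fun y => θ (-y))
        ((pruferF c χ (-x) + pruferV c χ (-x) * Real.sin (2 * θ (-x))) * (-1)) x :=
      HasDerivAt.comp x (hθ (-x) (hneg x hx)) (hasDerivAt_neg x)
    refine ((h1.add h2).sub_const (n * π)).congr_deriv ?_
    have hs : Real.sinc (u x) * u x = Real.sin (u x) := by
      by_cases h : u x = 0
      · simp [h]
      · rw [Real.sinc_of_ne_zero h]; field_simp
    have e : a x * u x = 2 * pruferV c χ x * Real.cos (θ x - θ (-x) + n * π) * Real.sin (u x) := by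
      rw [ha, ← hs]; ring
    rw [e, pr_feven, pr_vodd]
    have e2 : Real.sin (2 * θ x) + Real.sin (2 * θ (-x)) =
        2 * Real.sin (u x) * Real.cos (θ x - θ (-x) + n * π) := by
      have e3 : Real.sin (2 * θ (-x)) = -Real.sin (2 * (n * π - θ (-x))) := by
        have : 2 * (n * π - θ (-x)) = (n:ℝ) * (2 * π) - 2 * θ (-x) := by ring
        rw [this, Real.sin_nat_mul_two_pi_sub, neg_neg]
      rw [e3, ← sub_eq_add_neg, Real.sin_sub_sin]
      congr 3
      · simp only [hu]; ring
      · ring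
    linear_combination pruferV c χ x * e2
  -- near 1
  have hl' : Filter.Tendsto (fun x => θ (-x)) (nhdsWithin 1 (Iio 1)) (nhds 0) := by
    refine hl.comp ?_
    refine tendsto_nhdsWithin_iff.2 ⟨?_, ?_⟩
    · exact (continuous_neg.tendsto 1).mono_left nhdsWithin_le_nhds
    · filter_upwards [self_mem_nhdsWithin] with x hx
      simp only [mem_Iio] at hx
      simp only [mem_Ioi]
      linarith
  have hu0 : Filter.Tendsto u (nhdsWithin 1 (Iio 1)) (nhds 0) := by
    have := (hr.add hl').sub_const (n * π)
    convert this using 2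
    ring
  have hcos : Filter.Tendsto (fun x => Real.cos (θ x - θ (-x) + n * π)) (nhdsWithin 1 (Iio 1)) (nhds 1) := by
    have h1 := ((hr.sub hl').add_const (n * π))
    have h2 := (Real.continuous_cos.tendsto _).comp h1
    refine h2.trans (le_of_eq ?_)
    have : π * n - 0 + n * π = (n:ℝ) * (2 * π) := by ring
    rw [this, Real.cos_nat_mul_two_pi]
  have hsinc : Filter.Tendsto (fun x => Real.sinc (u x)) (nhdsWithin 1 (Iio 1)) (nhds 1) := by
    have h2 := (Real.continuous_sinc.tendsto _).comp hu0
    rwa [Real.sinc_zero] at h2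
  have hev := (hcos.eventually (lt_mem_nhds zero_lt_one)).and
    ((hsinc.eventually (lt_mem_nhds zero_lt_one)).and (Ioo_mem_nhdsLT (zero_lt_one (α := ℝ))))
  obtain ⟨b, hb, hb2⟩ := (mem_nhdsLT_iff_exists_Ioo_subset).1 hev
  simp only [mem_Iio] at hb
  -- u² monotone on (b,1)
  have hmem : ∀ x ∈ Ioo b 1, x ∈ Ioo (-1:ℝ) 1 := fun x hx => by
    have := (hb2 hx).2.2
    exact ⟨by linarith [this.1], this.2⟩
  have hd2 : ∀ x ∈ Ioo b 1, HasDerivAt (fun y => u y ^ 2) (2 * a x * u x^2) x := by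
    intro x hx
    refine ((hud x (hmem x hx)).pow 2).congr_deriv ?_
    push_cast
    ring
  have hmono : MonotoneOn (fun y => u y ^2) (Ioo b 1) := by
    refine monotoneOn_of_deriv_nonneg (convex_Ioo _ _)
      (fun y hy => (hd2 y hy).continuousAt.continuousWithinAt) ?_ ?_
    · rw [interior_Ioo]
      exact fun y hy => (hd2 y hy).differentiableAt.differentiableWithinAt
    · rw [interior_Ioo]
      intro y hy
      rw [(hd2 y hy).deriv]
      have h3 := hb2 hy
      have := pr_vpos hc hχ h3.2.2
      have h4 : 0 < a y := mul_pos (mul_pos (by linarith) h3.1) h3.2.1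
      positivity
  obtain ⟨x0, hx0⟩ := (nonempty_Ioo (a := b) (b := 1)).2 hb
  have hle : u x0 ^ 2 ≤ 0 := by
    have h5 : Filter.Tendsto (fun y => u y ^2) (nhdsWithin 1 (Iio 1)) (nhds 0) := by
      simpa using hu0.pow 2
    refine ge_of_tendsto h5 ?_
    filter_upwards [Ioo_mem_nhdsLT hx0.2] with y hy
    exact hmono hx0 ⟨by linarith [hx0.1, hy.1], hy.2⟩ hy.1.le
  have hz : u x0 = 0 := by
    have := le_antisymm hle (sq_nonneg _)
    exact pow_eq_zero_iff (two_ne_zero) |>.1 this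
  intro x hx
  have := pr_linear_zero a u hac hud x0 (hmem x0 hx0) hz x hx
  simp only [hu] at this
  linarith

/-- positivity of the derivative for `x > 0` -/
lemma pr_pos {c χ : ℝ} {n : ℕ} (hc : 0 < c) (hχ : χ > c^2) (θ : ℝ → ℝ)
    (hθ : ∀ x ∈ Ioo (-1:ℝ) 1, HasDerivAt θ (pruferF c χ x + pruferV c χ x * Real.sin (2 * θ x)) x)
    (hr : Filter.Tendsto θ (nhdsWithin 1 (Iio 1)) (nhds (π * n))) :
    ∀ x ∈ Ioo (0:ℝ) 1, 0 < pruferF c χ x + pruferV c χ x * Real.sin (2 * θ x) := by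
  intro x0 hx0
  by_contra hcon
  push Not at hcon
  have hm : ∀ x ∈ Ioo (0:ℝ) 1, x ∈ Ioo (-1:ℝ) 1 := fun x hx => ⟨by linarith [hx.1], hx.2⟩
  have hθc : ContinuousOn θ (Ioo (-1:ℝ) 1) :=
    fun x hx => (hθ x hx).continuousAt.continuousWithinAt
  have hvc := pr_vcont hχ
  set h : ℝ → ℝ := fun x => pruferF c χ x / pruferV c χ x + Real.sin (2 * θ x) with hh
  have hfac : ∀ x ∈ Ioo (0:ℝ) 1,
      pruferF c χ x + pruferV c χ x * Real.sin (2 * θ x) = pruferV c χ x * h x := by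
    intro x hx
    have := pr_vpos hc hχ hx
    simp only [hh]
    field_simp
  have hnon := pr_linear_nonpos (fun x => 2 * pruferV c χ x * Real.cos (2 * θ x)) h
    (fun x => deriv (fun x => pruferF c χ x / pruferV c χ x) x +
      Real.cos (2 * θ x) * (2 * (pruferV c χ x * h x))) (by
      refine (continuousOn_const.mul hvc).mul ?_
      exact Real.continuous_cos.comp_continuousOn (continuousOn_const.mul hθc)) (by
      intro x hx
      refine (pr_ratio_diff hc hχ hx).hasDerivAt.add ?_
      have := ((hθ x (hm x hx)).const_mul 2).sin
      rwa [hfac x hx] at this) (by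
      intro x hx
      have := pr_ratio_deriv hc hχ hx
      linarith) x0 hx0 (by
      have hv := pr_vpos hc hχ hx0
      rw [hfac x0 hx0] at hcon
      by_contra hc2
      push Not at hc2
      have := mul_pos hv hc2
      linarith)
  have hder : ∀ x ∈ Ico x0 1, pruferF c χ x + pruferV c χ x * Real.sin (2 * θ x) ≤ 0 := by
    intro x hx
    have hx' : x ∈ Ioo (0:ℝ) 1 := ⟨by linarith [hx.1, hx0.1], hx.2⟩
    rw [hfac x hx']
    exact mul_nonpos_of_nonneg_of_nonpos (pr_vpos hc hχ hx').le (hnon x hx' hx.1)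
  have hsub : ∀ x ∈ Ico x0 1, x ∈ Ioo (-1:ℝ) 1 := fun x hx => ⟨by linarith [hx.1, hx0.1], hx.2⟩
  have hanti : AntitoneOn θ (Ico x0 1) := by
    refine antitoneOn_of_deriv_nonpos (convex_Ico _ _)
      (fun y hy => (hθ y (hsub y hy)).continuousAt.continuousWithinAt) ?_ ?_
    · rw [interior_Ico]
      exact fun y hy => (hθ y (hsub y ⟨hy.1.le, hy.2⟩)).differentiableAt.differentiableWithinAt
    · rw [interior_Ico]
      intro y hy
      rw [(hθ y (hsub y ⟨hy.1.le, hy.2⟩)).deriv]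
      exact hder y ⟨hy.1.le, hy.2⟩
  have hge : ∀ x ∈ Ico x0 1, π * n ≤ θ x := by
    intro x hx
    refine le_of_tendsto hr ?_
    filter_upwards [Ioo_mem_nhdsLT hx.2] with y hy
    exact hanti hx ⟨by linarith [hx.1, hy.1], hy.2⟩ hy.1.le
  have hev := hr.eventually (gt_mem_nhds (show π * n < π * n + π / 2 by linarith [Real.pi_pos]))
  obtain ⟨x, hx1, hx2⟩ := (hev.and (Ioo_mem_nhdsLT hx0.2)).exists
  have hx3 : x ∈ Ico x0 1 := ⟨hx2.1.le, hx2.2⟩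
  have h1 := hge x hx3
  have hs : 0 ≤ Real.sin (2 * θ x) := by
    have : Real.sin (2 * θ x) = Real.sin (2 * θ x - n * (2 * π)) := (Real.sin_sub_nat_mul_two_pi _ _).symm
    rw [this]
    exact Real.sin_nonneg_of_nonneg_of_le_pi (by linarith) (by linarith)
  have hx4 : x ∈ Ioo (0:ℝ) 1 := ⟨by linarith [hx2.1, hx0.1], hx2.2⟩
  have := hder x hx3
  have h5 := pr_fpos hχ (hm x hx4)
  have h6 := mul_nonneg (pr_vpos hc hχ hx4).le hs
  linarith

lemma pr_sys {c χ : ℝ} {ψ : ℝ → ℝ} (hχ : χ > c^2) (ha : ∀ x : ℝ, AnalyticAt ℝ ψ x)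
    (hode : ∀ x : ℝ,
      (1 - x^2) * deriv (deriv ψ) x - 2*x * deriv ψ x + (χ - c^2 * x^2) * ψ x = 0) :
    Continuous ψ ∧ Continuous (deriv ψ) ∧
    (∀ x ∈ Ioo (-1:ℝ) 1, HasDerivAt ψ (pruferF c χ x * prW c χ ψ x) x) ∧
    (∀ x ∈ Ioo (-1:ℝ) 1, HasDerivAt (prW c χ ψ)
      (-pruferF c χ x * ψ x + 2 * pruferV c χ x * prW c χ ψ x) x) := by
  refine ⟨continuous_iff_continuousAt.2 fun x => (ha x).continuousAt,
    continuous_iff_continuousAt.2 fun x => (ha x).deriv.continuousAt, fun x hx => ?_, fun x hx => ?_⟩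
  · refine (ha x).differentiableAt.hasDerivAt.congr_deriv ?_
    rw [prW, ← mul_assoc, pr_gf hχ hx, one_mul]
  · exact pr_wderiv hχ hx (ha x).deriv.differentiableAt (hode x)

lemma pr_end' {c χ : ℝ} {ψ : ℝ → ℝ} (hc : 0 < c) (hχ : χ > c^2) (ha : ∀ x : ℝ, AnalyticAt ℝ ψ x)
    (hode : ∀ x : ℝ,
      (1 - x^2) * deriv (deriv ψ) x - 2*x * deriv ψ x + (χ - c^2 * x^2) * ψ x = 0)
    (x1 : ℝ) (hx1 : x1 ∈ Ioo (0:ℝ) 1) (hne : ψ x1 ≠ 0) : ψ 1 ≠ 0 := by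
  obtain ⟨h1, h2, h3, h4⟩ := pr_sys hχ ha hode
  exact pr_end hc hχ h1 h2 h3 h4 x1 hx1 hne

lemma pr_end_left {c χ : ℝ} {ψ : ℝ → ℝ} (hc : 0 < c) (hχ : χ > c^2) (ha : ∀ x : ℝ, AnalyticAt ℝ ψ x)
    (hode : ∀ x : ℝ,
      (1 - x^2) * deriv (deriv ψ) x - 2*x * deriv ψ x + (χ - c^2 * x^2) * ψ x = 0)
    (x1 : ℝ) (hx1 : x1 ∈ Ioo (-1:ℝ) 0) (hne : ψ x1 ≠ 0) : ψ (-1) ≠ 0 := by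
  have e1 : deriv (fun x => ψ (-x)) = fun x => - deriv ψ (-x) := by
    funext x; exact deriv_comp_neg ψ x
  refine pr_end' (ψ := fun x => ψ (-x)) hc hχ ?_ ?_ (-x1) ⟨by linarith [hx1.2], by linarith [hx1.1]⟩
    (by simpa using hne)
  · intro x
    exact (ha (-x)).fun_comp analyticAt_id.neg
  · intro x
    have e2 : deriv (fun x => - deriv ψ (-x)) x = deriv (deriv ψ) (-x) := by
      rw [deriv.fun_neg, deriv_comp_neg, neg_neg]
    rw [e1, e2]
    have := hode (-x)
    simp only
    linear_combination this

theorem prufer_theta_properties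
    (c : ℝ) (hc : 0 < c)
    (n : ℕ) (hn : 2 ≤ n)
    (ψn : ℝ → ℝ) (lamn : ℂ) (χn : ℝ)
    (hnd : ProlateDatum c n ψn lamn χn)
    (hχ : χn > c^2)
    (t : Fin n → ℝ) (ht_mono : StrictMono t)
    (ht_mem : ∀ j, t j ∈ Set.Ioo (-1:ℝ) 1)
    (ht_zero : ∀ j, ψn (t j) = 0)
    (θ : ℝ → ℝ)
    (hθ_ode : ∀ x ∈ Set.Ioo (-1:ℝ) 1,
      HasDerivAt θ (pruferF c χn x + pruferV c χn x * Real.sin (2 * θ x)) x)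
    (hθ_init : θ (t ⟨0, by omega⟩) = π/2) :
    (∃ θbar : ℝ → ℝ, ContinuousOn θbar (Set.Icc (-1:ℝ) 1) ∧
        Set.EqOn θbar θ (Set.Ioo (-1:ℝ) 1) ∧
        θbar (-1) = 0 ∧ θbar 1 = π * n) ∧
    θ 0 = π * n / 2 ∧
    (∀ i : Fin n, θ (t i) = ((i : ℝ) + 1 - 1/2) * π) ∧
    (∀ x ∈ Set.Ioo (-1:ℝ) 1,
      0 < pruferF c χn x + pruferV c χn x * Real.sin (2 * θ x)) ∧
    (∀ x ∈ Set.Ioo (-1:ℝ) 1, ψn x ≠ 0 →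
      θ x = Real.arctan (-Real.sqrt ((1 - x^2)/(χn - c^2*x^2)) * (deriv ψn x / ψn x))
        + ((Finset.univ.filter (fun j => t j < x)).card : ℝ) * π) := by
  have hn0 : 0 < n := by omega
  -- zeros
  have hZ : Set.range t = {x : ℝ | x ∈ Set.Ioo (-1:ℝ) 1 ∧ ψn x = 0} := by
    have hsub : Set.range t ⊆ {x : ℝ | x ∈ Set.Ioo (-1:ℝ) 1 ∧ ψn x = 0} := by
      rintro _ ⟨j, rfl⟩
      exact ⟨ht_mem j, ht_zero j⟩
    have hfin : {x : ℝ | x ∈ Set.Ioo (-1:ℝ) 1 ∧ ψn x = 0}.Finite := by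
      refine Set.finite_of_encard_eq_coe hnd.zeros_card
    refine (hfin.subset hsub).eq_of_subset_of_encard_le hsub ?_
    rw [hnd.zeros_card, ← Set.image_univ, ht_mono.injective.encard_image]
    simp
  have hzero : ∀ x ∈ Ioo (-1:ℝ) 1, ψn x = 0 ↔ ∃ j, x = t j := by
    intro x hx
    constructor
    · intro h
      have : x ∈ Set.range t := by rw [hZ]; exact ⟨hx, h⟩
      obtain ⟨j, hj⟩ := this
      exact ⟨j, hj.symm⟩
    · rintro ⟨j, rfl⟩
      exact ht_zero j
  have hnz : ∀ a b : ℝ, -1 ≤ a → b ≤ 1 → a < b → ∃ x ∈ Ioo a b, ψn x ≠ 0 := by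
    intro a b ha hb hab
    by_contra hcon
    push Not at hcon
    have hsub : Ioo a b ⊆ Set.range t := by
      intro x hx
      rw [hZ]
      exact ⟨⟨by linarith [hx.1], by linarith [hx.2]⟩, hcon x hx⟩
    exact (Ioo_infinite hab) ((Set.finite_range t).subset hsub)
  obtain ⟨hψc, hdc, hψd, hwd⟩ := pr_sys hχ hnd.analytic hnd.diff_eq
  obtain ⟨x1, hx1, hne1⟩ := hnz 0 1 (by norm_num) le_rfl zero_lt_one
  obtain ⟨x2, hx2, hne2⟩ := hnz (-1) 0 le_rfl (by norm_num) (by norm_num)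
  have hend1 := pr_end' hc hχ hnd.analytic hnd.diff_eq x1 hx1 hne1
  have hend2 := pr_end_left hc hχ hnd.analytic hnd.diff_eq x2 hx2 hne2
  obtain ⟨ρ, hρ⟩ := pr_polar _ _ ψn (prW c χn ψn) θ (pr_vcont hχ) hψd hwd hθ_ode _
    (ht_mem ⟨0, by omega⟩) (ht_zero _) hθ_init x1 ⟨by linarith [hx1.1], hx1.2⟩ hne1
  have hcosz : ∀ x ∈ Ioo (-1:ℝ) 1, Real.cos (θ x) = 0 ↔ ψn x = 0 := by
    intro x hx
    obtain ⟨h1, h2, -⟩ := hρ x hx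
    rw [h2, mul_eq_zero]
    simp [h1]
  obtain ⟨hii, hcount⟩ := pr_levels hn0 t ht_mono ht_mem θ _ hθ_ode (by
      intro x hx h
      rw [Real.sin_two_mul, h]
      simpa using pr_fpos hχ hx) (fun x hx => (hcosz x hx).trans (hzero x hx)) hθ_init
  have hiv : ∀ x ∈ Set.Ioo (-1:ℝ) 1, ψn x ≠ 0 →
      θ x = Real.arctan (-Real.sqrt ((1 - x^2)/(χn - c^2*x^2)) * (deriv ψn x / ψn x))
        + ((Finset.univ.filter (fun j => t j < x)).card : ℝ) * π := by
    intro x hx hne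
    have hcx : Real.cos (θ x) ≠ 0 := fun h => hne ((hcosz x hx).1 h)
    have h1 := abs_lt.1 (hcount x hx hcx)
    obtain ⟨h2, h3, h4⟩ := hρ x hx
    have e : -Real.sqrt ((1 - x^2)/(χn - c^2*x^2)) * (deriv ψn x / ψn x) = Real.tan (θ x) := by
      have : -Real.sqrt ((1 - x^2)/(χn - c^2*x^2)) * (deriv ψn x / ψn x) = - prW c χn ψn x / ψn x := by
        rw [prW]; ring
      rw [this, h3, h4, Real.tan_eq_sin_div_cos]
      field_simp
    rw [e, ← Real.tan_sub_nat_mul_pi (θ x) (Finset.univ.filter (fun j => t j < x)).card,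
      Real.arctan_tan h1.1 h1.2]
    ring
  -- limits
  have harc : ∀ a ∈ Icc (-1:ℝ) 1, ψn a ≠ 0 → ContinuousAt (fun x =>
      Real.arctan (-Real.sqrt ((1 - x^2)/(χn - c^2*x^2)) * (deriv ψn x / ψn x))) a := by
    intro a ha hne
    refine Real.continuous_arctan.continuousAt.comp ?_
    refine ContinuousAt.mul (ContinuousAt.neg (ContinuousAt.sqrt (ContinuousAt.div (by fun_prop)
      (by fun_prop) (pr_Q hχ ha).ne'))) (hdc.continuousAt.div hψc.continuousAt hne)
  have hr : Filter.Tendsto θ (nhdsWithin 1 (Iio 1)) (nhds (π * n)) := by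
    have h1 := ((harc 1 (by simp) hend1).tendsto.mono_left
      (nhdsWithin_le_nhds (s := Iio 1))).add_const ((n:ℝ) * π)
    have h2 : Filter.Tendsto (fun x =>
        Real.arctan (-Real.sqrt ((1 - x^2)/(χn - c^2*x^2)) * (deriv ψn x / ψn x)) + (n:ℝ) * π)
        (nhdsWithin 1 (Iio 1)) (nhds (π * n)) := by
      convert h1 using 2
      simp [mul_comm]
    refine h2.congr' ?_
    have hlast := ht_mem ⟨n-1, by omega⟩
    filter_upwards [Ioo_mem_nhdsLT hlast.2] with x hx
    have hx' : x ∈ Ioo (-1:ℝ) 1 := ⟨by linarith [hx.1, hlast.1], hx.2⟩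
    have hall : ∀ j, t j < x := fun j =>
      lt_of_le_of_lt (ht_mono.monotone (by rw [Fin.le_def]; simp only; omega)) hx.1
    have hne : ψn x ≠ 0 := by
      intro h
      obtain ⟨j, hj⟩ := (hzero x hx').1 h
      exact (hall j).ne hj.symm
    rw [hiv x hx' hne, Finset.filter_true_of_mem (fun j _ => hall j)]
    simp
  have hl : Filter.Tendsto θ (nhdsWithin (-1) (Ioi (-1))) (nhds 0) := by
    have h1 := ((harc (-1) (by simp) hend2).tendsto.mono_left
      (nhdsWithin_le_nhds (s := Ioi (-1))))
    have h2 : Filter.Tendsto (fun x =>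
        Real.arctan (-Real.sqrt ((1 - x^2)/(χn - c^2*x^2)) * (deriv ψn x / ψn x)))
        (nhdsWithin (-1) (Ioi (-1))) (nhds 0) := by
      convert h1 using 2
      simp
    refine h2.congr' ?_
    have hfirst := ht_mem ⟨0, by omega⟩
    filter_upwards [Ioo_mem_nhdsGT hfirst.1] with x hx
    have hx' : x ∈ Ioo (-1:ℝ) 1 := ⟨hx.1, by linarith [hx.2, hfirst.2]⟩
    have hall : ∀ j, x < t j := fun j =>
      lt_of_lt_of_le hx.2 (ht_mono.monotone (by rw [Fin.le_def]; simp))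
    have hne : ψn x ≠ 0 := by
      intro h
      obtain ⟨j, hj⟩ := (hzero x hx').1 h
      exact (hall j).ne hj
    rw [hiv x hx' hne, Finset.filter_false_of_mem (fun j _ => (hall j).not_gt)]
    simp
  have hsymm := pr_symm hc hχ θ hθ_ode hl hr
  have hposr := pr_pos hc hχ θ hθ_ode hr
  refine ⟨⟨extendFrom (Ioo (-1:ℝ) 1) θ, ?_, ?_, ?_, ?_⟩, ?_, hii, ?_, hiv⟩
  · have hθc : ContinuousOn θ (Ioo (-1:ℝ) 1) :=
      fun x hx => (hθ_ode x hx).continuousAt.continuousWithinAt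
    exact continuousOn_Icc_extendFrom_Ioo hθc hl hr
  · intro x hx
    exact extendFrom_eq (by rw [closure_Ioo (by norm_num)]; exact Ioo_subset_Icc_self hx)
      ((hθ_ode x hx).continuousAt.tendsto.mono_left nhdsWithin_le_nhds)
  · exact eq_lim_at_left_extendFrom_Ioo (by norm_num) hl
  · exact eq_lim_at_right_extendFrom_Ioo (by norm_num) hr
  · have := hsymm 0 (by constructor <;> norm_num)
    rw [neg_zero] at this
    linarith
  · intro x hx
    rcases lt_trichotomy x 0 with h | h | h
    · have h1 := hposr (-x) ⟨by linarith, by linarith [hx.1]⟩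
      rw [pr_feven, pr_vodd, hsymm x hx] at h1
      have : 2 * (n * π - θ x) = (n:ℝ) * (2 * π) - 2 * θ x := by ring
      rw [this, Real.sin_nat_mul_two_pi_sub] at h1
      linarith
    · have := pr_fpos hχ hx
      have hv : pruferV c χn x = 0 := by simp [pruferV, h]
      rw [hv, zero_mul, add_zero]
      exact this
    · exact hposr x ⟨h, hx.2⟩
end

section
/- Let c > 0 be a real number and n ≥ 0 an integer, and let Ψ : ℂ → ℂ be the entire function defined by Ψ(z) = λ_n^{-1}·∫_{-1}^{1} ψ_n(t)·exp(i·c·z·t) dt (so Ψ agrees with ψ_n on ℝ). Then every zero of Ψ in ℂ is real and is a simple zero, Ψ has infinitely many zeros in the interval (1, ∞), and the differential equation (1−z²)·Ψ''(z) − 2z·Ψ'(z) + (χ_n − c²z²)·Ψ(z) = 0 holds for all complex z. -/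
open Real MeasureTheory Set

open scoped FourierTransform ContDiff SchwartzMap in
lemma fourier_L2_ae (f : ℝ → ℂ) (h1 : Integrable f) (h2 : MemLp f 2) :
    (𝓕 (h2.toLp f) : Lp ℂ 2 (volume : Measure ℝ)) =ᵐ[volume] 𝓕 f := by
  have hcont : Continuous (𝓕 f) :=
    VectorFourier.fourierIntegral_continuous Real.continuous_fourierChar (by exact continuous_inner) h1
  apply ae_eq_of_integral_contDiff_smul_eq
  · exact (Lp.memLp _).locallyIntegrable (by norm_num)
  · exact hcont.locallyIntegrable
  intro g hg hgc
  have hg1 : HasCompactSupport (Complex.ofRealCLM ∘ g) := hgc.comp_left rfl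
  have hg2 : ContDiff ℝ ∞ (Complex.ofRealCLM ∘ g) := Complex.ofRealCLM.contDiff.comp hg
  set G : 𝓢(ℝ, ℂ) := hg1.toSchwartzMap hg2 with hG
  have hGx : ∀ x, G x = (g x : ℂ) := fun x => rfl
  have key := congrArg (fun T => T G) (Lp.fourier_toTemperedDistribution_eq (h2.toLp f))
  simp only [TemperedDistribution.fourier_apply, Lp.toTemperedDistribution_apply] at key
  have e1 : ∫ x, g x • (𝓕 (h2.toLp f) : Lp ℂ 2 (volume : Measure ℝ)) x = ∫ x, G x • (𝓕 (h2.toLp f) : Lp ℂ 2 (volume : Measure ℝ)) x := by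
    congr with x
  have e2 : ∫ x, (𝓕 G) x • (h2.toLp f) x = ∫ x, (𝓕 G) x • f x := by
    apply integral_congr_ae
    filter_upwards [h2.coeFn_toLp] with x hx
    rw [hx]
  have e3 : ∫ x, g x • (𝓕 f) x = ∫ x, (𝓕 f) x • G x := by
    congr with x
    simp [hGx, mul_comm]
  rw [e1, ← key, e2, e3]
  have := VectorFourier.integral_fourierIntegral_smul_eq_flip (μ := volume) (ν := volume) (L := innerₗ ℝ)
    Real.continuous_fourierChar (by exact continuous_inner) h1 G.integrable
  have h4 : (innerₗ ℝ).flip = innerₗ ℝ := flip_innerₗ ℝ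
  rw [h4] at this
  refine Eq.trans ?_ this.symm
  congr with x
  rw [SchwartzMap.fourier_coe, smul_eq_mul, smul_eq_mul, mul_comm]
  rfl

open scoped FourierTransform in
lemma fourier_plancherel (f g : ℝ → ℂ) (h1 : Integrable f) (h2 : MemLp f 2)
    (h1' : Integrable g) (h2' : MemLp g 2) :
    MemLp (𝓕 f) 2 ∧ ∫ x, 𝓕 g x * star (𝓕 f x) = ∫ x, g x * star (f x) := by
  constructor
  · exact (memLp_congr_ae (fourier_L2_ae f h1 h2)).1 (Lp.memLp _)
  · have := Lp.inner_fourier_eq (h2.toLp f) (h2'.toLp g)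
    rw [L2.inner_def, L2.inner_def] at this
    convert this using 1
    · apply integral_congr_ae
      filter_upwards [fourier_L2_ae f h1 h2, fourier_L2_ae g h1' h2'] with x hx hx'
      rw [hx, hx']; simp
    · apply integral_congr_ae
      filter_upwards [h2.coeFn_toLp, h2'.coeFn_toLp] with x hx hx'
      rw [hx, hx']; simp

/-- Band-limited transform. -/
noncomputable def bandT (c : ℝ) (h : ℝ → ℂ) (x : ℝ) : ℂ :=
  ∫ t in (-1:ℝ)..1, h t * Complex.exp (Complex.I * (c:ℂ) * (x:ℂ) * (t:ℂ))

open scoped FourierTransform in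
lemma bandT_eq_fourier (c : ℝ) (h : ℝ → ℂ) (x : ℝ) :
    bandT c h x = 𝓕 (indicator (Ioc (-1:ℝ) 1) h) (-(c / (2 * π)) * x) := by
  rw [bandT, Real.fourier_eq', intervalIntegral.integral_of_le (by norm_num),
    ← integral_indicator measurableSet_Ioc]
  congr with t
  by_cases ht : t ∈ Ioc (-1:ℝ) 1
  · simp only [indicator_of_mem ht, smul_eq_mul]
    rw [mul_comm]
    congr 2
    simp only [RCLike.inner_apply, conj_trivial]
    push_cast
    field_simp
  · simp only [indicator_of_notMem ht, smul_zero]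

lemma bandT_plancherel (c : ℝ) (hc : 0 < c) (f g : ℝ → ℂ) (hf : Continuous f) (hg : Continuous g) :
    MemLp (bandT c f) 2 ∧ ∫ x, bandT c g x * star (bandT c f x) =
      ((2 * π / c : ℝ) : ℂ) * ∫ t in (-1:ℝ)..1, g t * star (f t) := by
  have hfint : ∀ f : ℝ → ℂ, Continuous f → Integrable (indicator (Ioc (-1:ℝ) 1) f) := by
    intro f hf
    rw [integrable_indicator_iff measurableSet_Ioc]
    exact (hf.integrableOn_Icc (a := -1) (b := 1)).mono_set Ioc_subset_Icc_self
  have hmem : ∀ f : ℝ → ℂ, Continuous f → MemLp (indicator (Ioc (-1:ℝ) 1) f) 2 := by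
    intro f hf
    rw [memLp_indicator_iff_restrict measurableSet_Ioc]
    refine (memLp_two_iff_integrable_sq_norm hf.aestronglyMeasurable).2 ?_
    exact ((hf.norm.pow 2).integrableOn_Icc (a := -1) (b := 1)).mono_set Ioc_subset_Icc_self
  obtain ⟨p1, p2⟩ := fourier_plancherel _ _ (hfint f hf) (hmem f hf) (hfint g hg) (hmem g hg)
  have ha : -(c / (2 * π)) ≠ 0 := by
    have := Real.pi_pos
    have : 0 < c / (2 * π) := by positivity
    linarith
  constructor
  · have : bandT c f = fun x => FourierTransform.fourier (indicator (Ioc (-1:ℝ) 1) f) (-(c / (2 * π)) * x) :=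
      funext (bandT_eq_fourier c f)
    rw [this]
    have hq : Integrable (fun x : ℝ => ‖FourierTransform.fourier (indicator (Ioc (-1:ℝ) 1) f) (-(c / (2 * π)) * x)‖^2) :=
      (p1.integrable_norm_pow (by norm_num)).comp_mul_left' ha
    have hcont : Continuous (FourierTransform.fourier (indicator (Ioc (-1:ℝ) 1) f)) :=
      VectorFourier.fourierIntegral_continuous Real.continuous_fourierChar (by exact continuous_inner) (hfint f hf)
    refine (memLp_two_iff_integrable_sq_norm ?_).2 hq
    exact (hcont.comp (by fun_prop)).aestronglyMeasurable
  · simp_rw [bandT_eq_fourier]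
    rw [Measure.integral_comp_mul_left (fun y => FourierTransform.fourier (indicator (Ioc (-1:ℝ) 1) g) y * star (FourierTransform.fourier (indicator (Ioc (-1:ℝ) 1) f) y)), p2,
      intervalIntegral.integral_of_le (by norm_num),
      ← integral_indicator measurableSet_Ioc]
    rw [Complex.real_smul]
    congr 1
    · congr 1
      rw [inv_neg, abs_neg, abs_of_pos (by have := Real.pi_pos; positivity), inv_div]
    · congr with t
      by_cases ht : t ∈ Ioc (-1:ℝ) 1
      · simp only [indicator_of_mem ht]
      · simp only [indicator_of_notMem ht, zero_mul]

/-- The analytic continuation integral is entire. -/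
lemma bandC_differentiable (c : ℝ) (h : ℝ → ℂ) (hh : Continuous h) :
    Differentiable ℂ (fun z : ℂ =>
      ∫ t in (-1:ℝ)..1, h t * Complex.exp (Complex.I * (c:ℂ) * z * (t:ℂ))) := by
  intro z₀
  have hF' : Continuous (fun p : ℂ × ℝ =>
    h p.2 * (Complex.exp (Complex.I * (c:ℂ) * p.1 * (p.2:ℂ)) * (Complex.I * c * p.2))) := by
    fun_prop
  obtain ⟨C, hC⟩ := ((isCompact_closedBall z₀ 1).prod (isCompact_Icc (a := (-1:ℝ)) (b := 1))).exists_bound_of_continuousOn hF'.continuousOn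
  have := intervalIntegral.hasDerivAt_integral_of_dominated_loc_of_deriv_le (μ := volume) (a := -1) (b := 1)
    (F := fun (z : ℂ) (t : ℝ) => h t * Complex.exp (Complex.I * (c:ℂ) * z * (t:ℂ)))
    (F' := fun (z : ℂ) (t : ℝ) => h t * (Complex.exp (Complex.I * (c:ℂ) * z * (t:ℂ)) * (Complex.I * c * t)))
    (x₀ := z₀) (s := Metric.ball z₀ 1) (bound := fun _ => C)
    (Metric.ball_mem_nhds _ one_pos) ?_ ?_ ?_ ?_ ?_ ?_
  · exact this.2.differentiableAt
  · filter_upwards with z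
    exact (Continuous.aestronglyMeasurable (by fun_prop))
  · exact Continuous.intervalIntegrable (by fun_prop) _ _
  · exact (Continuous.aestronglyMeasurable (by fun_prop))
  · filter_upwards with t ht z hz
    refine hC (z, t) ⟨Metric.ball_subset_closedBall hz, ?_⟩
    rw [uIoc_of_le (by norm_num)] at ht
    exact Ioc_subset_Icc_self ht
  · simp
  · filter_upwards with t ht z hz
    refine HasDerivAt.const_mul _ ?_
    refine HasDerivAt.cexp ?_
    have := ((hasDerivAt_id z).const_mul (Complex.I * (c:ℂ))).mul_const (t:ℂ)
    simpa using this

/-- Real and complex derivative compatibility. -/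
lemma hasDerivAt_real_of_ext (F : ℂ → ℂ) (f : ℝ → ℝ) (hF : Differentiable ℂ F)
    (hFf : ∀ x : ℝ, F x = f x) (x : ℝ) (hf : DifferentiableAt ℝ f x) :
    deriv F (x:ℂ) = ((deriv f x : ℝ) : ℂ) := by
  have h1 : HasDerivAt (fun y : ℝ => F y) (deriv F x) x := (hF x).hasDerivAt.comp_ofReal
  have h2 : HasDerivAt (fun y : ℝ => ((f y : ℝ) : ℂ)) ((deriv f x : ℝ) : ℂ) x := hf.hasDerivAt.ofReal_comp
  have : (fun y : ℝ => F y) = fun y : ℝ => ((f y : ℝ) : ℂ) := funext hFf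
  rw [this] at h1
  exact h1.unique h2

/-- Two entire functions agreeing on the reals are equal. -/
lemma entire_zero_of_real (F : ℂ → ℂ) (hF : Differentiable ℂ F) (h : ∀ x : ℝ, F x = 0) (z : ℂ) :
    F z = 0 := by
  have hA : AnalyticOnNhd ℂ F univ := fun z _ => hF.analyticAt z
  have hB : AnalyticOnNhd ℂ (fun _ : ℂ => (0:ℂ)) univ := fun z _ => analyticAt_const
  have : F = fun _ => 0 := by
    apply hA.eq_of_frequently_eq (z₀ := 0) hB
    have h1 : Filter.Tendsto (fun x : ℝ => (x:ℂ)) (nhdsWithin 0 {0}ᶜ) (nhdsWithin 0 {0}ᶜ) := by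
      apply tendsto_nhdsWithin_of_tendsto_nhds_of_eventually_within
      · have : ContinuousAt (fun x : ℝ => (x:ℂ)) 0 := Complex.continuous_ofReal.continuousAt
        simpa using this.tendsto.mono_left nhdsWithin_le_nhds
      · filter_upwards [self_mem_nhdsWithin] with x hx
        simpa using hx
    exact h1.frequently (Filter.Frequently.of_forall h)
  exact congrFun this z

/-- Entire extension satisfies ODE. -/
lemma ode_ext (c χ : ℝ) (F : ℂ → ℂ) (f : ℝ → ℝ) (hF : Differentiable ℂ F)
    (hFf : ∀ x : ℝ, F x = f x) (hf : ∀ x : ℝ, AnalyticAt ℝ f x)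
    (hode : ∀ x : ℝ,
      (1 - x^2) * deriv (deriv f) x - 2*x * deriv f x + (χ - c^2 * x^2) * f x = 0) (z : ℂ) :
    (1 - z^2) * deriv (deriv F) z - 2*z * deriv F z
      + ((χ:ℂ) - (c:ℂ)^2 * z^2) * F z = 0 := by
  have hF1 : Differentiable ℂ (deriv F) := hF.deriv
  have hF2 : Differentiable ℂ (deriv (deriv F)) := hF1.deriv
  refine entire_zero_of_real (fun z => (1 - z^2) * deriv (deriv F) z - 2*z * deriv F z
      + ((χ:ℂ) - (c:ℂ)^2 * z^2) * F z) (by fun_prop) (fun x => ?_) z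
  have e1 : ∀ x : ℝ, deriv F (x:ℂ) = ((deriv f x : ℝ) : ℂ) := fun x =>
    hasDerivAt_real_of_ext F f hF hFf x (hf x).differentiableAt
  have e2 : ∀ x : ℝ, deriv (deriv F) (x:ℂ) = ((deriv (deriv f) x : ℝ) : ℂ) := fun x =>
    hasDerivAt_real_of_ext _ _ hF1 e1 x (hf x).deriv.differentiableAt
  simp only [e1, e2, hFf]
  exact_mod_cast hode x

/-- Zeros of a nontrivial entire solution are simple. -/
lemma simple_zeros (c χ : ℝ) (F : ℂ → ℂ) (hF : Differentiable ℂ F)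
    (hode : ∀ z : ℂ, (1 - z^2) * deriv (deriv F) z - 2*z * deriv F z
      + ((χ:ℂ) - (c:ℂ)^2 * z^2) * F z = 0) (hne : ∃ w, F w ≠ 0) (z : ℂ) (hz : F z = 0) :
    deriv F z ≠ 0 := by
  intro hd
  have hA : AnalyticOnNhd ℂ F univ := fun z _ => hF.analyticAt z
  have hnev : ¬ ∀ᶠ w in nhds z, F w = 0 := by
    intro h
    obtain ⟨w, hw⟩ := hne
    exact hw (congrFun (hA.eq_of_eventuallyEq (z₀ := z) (fun z _ => analyticAt_const) h) w)
  obtain ⟨m, g, hg, hg0, hev⟩ := (hF.analyticAt z).exists_eventuallyEq_pow_smul_nonzero_iff.2 hnev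
  have hev' : F =ᶠ[nhds z] fun w => (w - z)^m * g w := hev
  have hg1 := hg.deriv
  have hg2 := hg1.deriv
  have hd1 : deriv F =ᶠ[nhds z] fun w => (m * (w - z)^(m-1)) * g w + (w - z)^m * deriv g w := by
    filter_upwards [hev'.deriv, hg.eventually_analyticAt] with w hw hgw
    rw [hw]
    have h1 : HasDerivAt (fun w : ℂ => (w - z)^m) (m * (w-z)^(m-1)) w := by
      simpa using ((hasDerivAt_id w).sub_const z).fun_pow m
    exact (h1.mul hgw.differentiableAt.hasDerivAt).deriv
  have hm0 : m ≠ 0 := by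
    rintro rfl
    have := hev'.eq_of_nhds
    simp [hz] at this
    exact hg0 this.symm
  have hm1 : m ≠ 1 := by
    rintro rfl
    have := hd1.eq_of_nhds
    simp [hd] at this
    exact hg0 this.symm
  obtain ⟨k, rfl⟩ : ∃ k, m = k + 2 := ⟨m - 2, by omega⟩
  have hd2 : deriv (deriv F) =ᶠ[nhds z] fun w => (((k:ℂ)+2) * (k+1) * (w - z)^k) * g w
      + 2 * ((k+2) * (w - z)^(k+1) * deriv g w) + (w - z)^(k+2) * deriv (deriv g) w := by
    filter_upwards [hd1.deriv, hg.eventually_analyticAt] with w hw hgw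
    rw [hw]
    have h1 : HasDerivAt (fun w : ℂ => (w - z)^(k+2)) (((k+2 : ℕ):ℂ) * (w-z)^(k+1)) w := by
      simpa using ((hasDerivAt_id w).sub_const z).fun_pow (k+2)
    have h2 : HasDerivAt (fun w : ℂ => (w - z)^(k+1)) (((k+1 : ℕ):ℂ) * (w-z)^k) w := by
      simpa using ((hasDerivAt_id w).sub_const z).fun_pow (k+1)
    have := (((h2.const_mul ((k+2 : ℕ):ℂ)).mul hgw.differentiableAt.hasDerivAt).add
      (h1.mul hgw.deriv.differentiableAt.hasDerivAt)).deriv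
    refine Eq.trans ?_ (this.trans ?_)
    · rfl
    · push_cast; ring
  by_cases hz1 : z^2 = 1
  · -- divide by (w - z)^(k+1)
    have hcont : ContinuousAt (fun w => -(w + z) * ((((k:ℂ)+2) * (k+1)) * g w
      + 2 * ((k+2) * (w - z) * deriv g w) + (w - z)^2 * deriv (deriv g) w)
      - 2 * w * ((k+2) * g w + (w - z) * deriv g w) + ((χ:ℂ) - (c:ℂ)^2 * w^2) * ((w - z) * g w)) z := by
      have := hg.continuousAt
      have := hg1.continuousAt
      have := hg2.continuousAt
      fun_prop
    have hzero : ∀ᶠ w in nhdsWithin z {z}ᶜ, (fun w => -(w + z) * ((((k:ℂ)+2) * (k+1)) * g w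
      + 2 * ((k+2) * (w - z) * deriv g w) + (w - z)^2 * deriv (deriv g) w)
      - 2 * w * ((k+2) * g w + (w - z) * deriv g w) + ((χ:ℂ) - (c:ℂ)^2 * w^2) * ((w - z) * g w)) w = 0 := by
      filter_upwards [self_mem_nhdsWithin, nhdsWithin_le_nhds hev', nhdsWithin_le_nhds hd1,
        nhdsWithin_le_nhds hd2] with w hw h0 h1 h2
      have hw' : w - z ≠ 0 := sub_ne_zero.2 hw
      have h := hode w
      rw [h0, h1, h2] at h
      have h1z : 1 - w^2 = -(w - z) * (w + z) := by rw [← hz1]; ring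
      rw [h1z] at h
      apply mul_left_cancel₀ (pow_ne_zero (k+1) hw')
      rw [mul_zero, ← h]
      simp only [Nat.add_sub_cancel, show k + 2 - 1 = k + 1 from rfl]
      push_cast
      ring
    have hlim := tendsto_nhds_unique (hcont.tendsto.mono_left nhdsWithin_le_nhds)
      (tendsto_const_nhds.congr' (hzero.mono fun w hw => hw.symm))
    simp only [sub_self, zero_mul, mul_zero, zero_pow two_ne_zero, add_zero] at hlim
    have hz0 : z ≠ 0 := by rintro rfl; simp at hz1
    have hk : ((k:ℂ)+2)^2 ≠ 0 := pow_ne_zero _ (by exact_mod_cast (by omega : k + 2 ≠ 0))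
    have : z * ((k:ℂ)+2)^2 * g z = 0 := by linear_combination (-1/2) * hlim
    exact (mul_ne_zero (mul_ne_zero hz0 hk) hg0) this
  · have hcont : ContinuousAt (fun w => (1 - w^2) * ((((k:ℂ)+2) * (k+1)) * g w
      + 2 * ((k+2) * (w - z) * deriv g w) + (w - z)^2 * deriv (deriv g) w)
      - 2 * w * ((k+2) * (w - z) * g w + (w - z)^2 * deriv g w) + ((χ:ℂ) - (c:ℂ)^2 * w^2) * ((w - z)^2 * g w)) z := by
      have := hg.continuousAt
      have := hg1.continuousAt
      have := hg2.continuousAt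
      fun_prop
    have hzero : ∀ᶠ w in nhdsWithin z {z}ᶜ, (fun w => (1 - w^2) * ((((k:ℂ)+2) * (k+1)) * g w
      + 2 * ((k+2) * (w - z) * deriv g w) + (w - z)^2 * deriv (deriv g) w)
      - 2 * w * ((k+2) * (w - z) * g w + (w - z)^2 * deriv g w) + ((χ:ℂ) - (c:ℂ)^2 * w^2) * ((w - z)^2 * g w)) w = 0 := by
      filter_upwards [self_mem_nhdsWithin, nhdsWithin_le_nhds hev', nhdsWithin_le_nhds hd1,
        nhdsWithin_le_nhds hd2] with w hw h0 h1 h2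
      have hw' : w - z ≠ 0 := sub_ne_zero.2 hw
      have h := hode w
      rw [h0, h1, h2] at h
      apply mul_left_cancel₀ (pow_ne_zero k hw')
      rw [mul_zero, ← h]
      simp only [show k + 2 - 1 = k + 1 from rfl]
      push_cast
      ring
    have hlim := tendsto_nhds_unique (hcont.tendsto.mono_left nhdsWithin_le_nhds)
      (tendsto_const_nhds.congr' (hzero.mono fun w hw => hw.symm))
    simp only [sub_self, zero_mul, mul_zero, zero_pow two_ne_zero, add_zero, sub_zero] at hlim
    have hk : ((k:ℂ)+2) ≠ 0 := by exact_mod_cast (by omega : k + 2 ≠ 0)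
    have hk' : ((k:ℂ)+1) ≠ 0 := by exact_mod_cast (by omega : k + 1 ≠ 0)
    exact (mul_ne_zero (sub_ne_zero.2 (Ne.symm hz1)) (mul_ne_zero (mul_ne_zero hk hk') hg0)) hlim

/-- Sturm comparison: no positive solution near infinity. -/
lemma sturm_pos (c χ X : ℝ) (hc : 0 < c) (f : ℝ → ℝ) (hf : ∀ x : ℝ, AnalyticAt ℝ f x)
    (hode : ∀ x : ℝ,
      (1 - x^2) * deriv (deriv f) x - 2*x * deriv f x + (χ - c^2 * x^2) * f x = 0)
    (hpos : ∀ x, X < x → 0 < f x) : False := by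
  obtain ⟨a, ha1, haX, haχ⟩ : ∃ a : ℝ, 1 < a ∧ X < a ∧ 2 * χ ≤ c^2 * a := by
    refine ⟨max 1 (max X (2 * χ / c^2)) + 1, ?_, ?_, ?_⟩
    · linarith [le_max_left 1 (max X (2 * χ / c^2))]
    · linarith [le_max_right 1 (max X (2 * χ / c^2)), le_max_left X (2 * χ / c^2)]
    · have : 2 * χ / c^2 ≤ max 1 (max X (2 * χ / c^2)) + 1 := by
        linarith [le_max_right 1 (max X (2 * χ / c^2)), le_max_right X (2 * χ / c^2)]
      rw [div_le_iff₀ (by positivity)] at this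
      linarith
  set m := c / 2 with hm
  have hmpos : 0 < m := by positivity
  set b := a + π / m with hb
  have hab : a < b := by have := Real.pi_pos; have : 0 < π / m := by positivity
                         linarith
  let s : ℝ → ℝ := fun x => √(x^2 - 1)
  let u : ℝ → ℝ := fun x => s x * f x
  let u' : ℝ → ℝ := fun x => x / s x * f x + s x * deriv f x
  let v : ℝ → ℝ := fun x => Real.sin (m * (x - a))
  let v' : ℝ → ℝ := fun x => m * Real.cos (m * (x - a))
  let W : ℝ → ℝ := fun x => u' x * v x - u x * v' x
  have hspos : ∀ x ∈ Icc a b, 0 < s x := fun x hx => Real.sqrt_pos.2 (by nlinarith [hx.1])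
  have hs2 : ∀ x ∈ Icc a b, s x ^ 2 = x^2 - 1 := fun x hx => Real.sq_sqrt (by nlinarith [hx.1])
  have hs' : ∀ x ∈ Icc a b, HasDerivAt s (x / s x) x := by
    intro x hx
    have h1 : HasDerivAt (fun x : ℝ => x^2 - 1) (2 * x) x := by
      simpa using (hasDerivAt_pow 2 x).sub_const 1
    have := h1.sqrt (by nlinarith [hx.1])
    convert this using 1
    have := hspos x hx
    simp only [s] at this ⊢
    field_simp
  have hW : ∀ x ∈ Icc a b, HasDerivAt W
      (-(((c^2 * x^2 - χ) / (x^2 - 1) + 1 / (x^2-1)^2 - m^2) * (u x * v x))) x := by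
    intro x hx
    have hsx := hspos x hx
    have hs2x := hs2 x hx
    have hpx : 0 < x^2 - 1 := by nlinarith [hx.1]
    have d1 := hs' x hx
    have df := (hf x).differentiableAt.hasDerivAt
    have ddf := (hf x).deriv.differentiableAt.hasDerivAt
    have du : HasDerivAt u (u' x) x := d1.mul df
    have du' : HasDerivAt u' ((1 * s x - x * (x / s x)) / (s x)^2 * f x + x / s x * deriv f x
        + (x / s x * deriv f x + s x * deriv (deriv f) x)) x :=
      ((((hasDerivAt_id x).div d1 hsx.ne').mul df)).add (d1.mul ddf)
    have dl : HasDerivAt (fun x => m * (x - a)) m x := by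
      simpa using ((hasDerivAt_id x).sub_const a).const_mul m
    have dv : HasDerivAt v (Real.cos (m * (x - a)) * m) x := dl.sin
    have dv' : HasDerivAt v' (m * (-Real.sin (m * (x - a)) * m)) x := dl.cos.const_mul m
    have := (du'.mul dv).sub (du.mul dv')
    refine this.congr_deriv ?_
    have hode' := hode x
    simp only [u', u, v, v']
    generalize Real.sin (m * (x - a)) = S
    generalize Real.cos (m * (x - a)) = C
    generalize deriv f x = f1 at *
    have hf2 : deriv (deriv f) x = (-(2 * x * f1) + (χ - c^2 * x^2) * f x) / (x^2 - 1) := by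
      rw [eq_div_iff hpx.ne']; linarith
    rw [hf2]
    generalize f x = f0 at *
    rw [← hs2x]
    generalize s x = σ at *
    have hx2 : x^2 = σ^2 + 1 := by linarith
    field_simp
    have h4 : x^4 = (σ^2+1)^2 := by rw [← hx2]; ring
    ring_nf
    simp only [hx2, h4]
    ring
  have hvnn : ∀ x ∈ Icc a b, 0 ≤ v x := by
    intro x hx
    apply Real.sin_nonneg_of_nonneg_of_le_pi
    · exact mul_nonneg hmpos.le (by linarith [hx.1])
    · have : m * (x - a) ≤ m * (π / m) := by gcongr; linarith [hx.2]
      rwa [mul_div_cancel₀ _ hmpos.ne'] at this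
  have hanti : AntitoneOn W (Icc a b) := by
    apply antitoneOn_of_deriv_nonpos (convex_Icc a b)
    · exact fun x hx => (hW x hx).continuousAt.continuousWithinAt
    · intro x hx
      rw [interior_Icc] at hx
      exact (hW x (Ioo_subset_Icc_self hx)).differentiableAt.differentiableWithinAt
    · intro x hx
      rw [interior_Icc] at hx
      have hx' := Ioo_subset_Icc_self hx
      rw [(hW x hx').deriv]
      have hpx : 0 < x^2 - 1 := by nlinarith [hx.1]
      have h1 : m^2 ≤ (c^2 * x^2 - χ) / (x^2 - 1) := by
        rw [le_div_iff₀ hpx, hm]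
        have : c^2 * a ≤ c^2 * x^2 := by
          gcongr; nlinarith [hx.1]
        nlinarith [sq_nonneg c]
      have h2 : 0 ≤ 1 / (x^2-1)^2 := by positivity
      have h3 : 0 ≤ u x * v x := mul_nonneg (mul_nonneg (hspos x hx').le (hpos x (by linarith [hx.1])).le) (hvnn x hx')
      have := mul_nonneg (by linarith : 0 ≤ (c^2 * x^2 - χ) / (x^2 - 1) + 1 / (x^2-1)^2 - m^2) h3
      linarith
  have hfin := hanti (left_mem_Icc.2 hab.le) (right_mem_Icc.2 hab.le) hab.le
  have hva : W a = - (u a * m) := by simp [W, v, v']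
  have hvb : W b = u b * m := by
    have : m * (b - a) = π := by rw [hb]; field_simp; ring
    simp [W, v, v', this]
  have hua : 0 < u a := mul_pos (hspos a (left_mem_Icc.2 hab.le)) (hpos a haX)
  have hub : 0 < u b := mul_pos (hspos b (right_mem_Icc.2 hab.le)) (hpos b (by linarith))
  rw [hva, hvb] at hfin
  nlinarith [mul_pos hua hmpos, mul_pos hub hmpos]

lemma infinite_zeros (c χ : ℝ) (hc : 0 < c) (f : ℝ → ℝ) (hf : ∀ x : ℝ, AnalyticAt ℝ f x)
    (hode : ∀ x : ℝ,
      (1 - x^2) * deriv (deriv f) x - 2*x * deriv f x + (χ - c^2 * x^2) * f x = 0) :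
    {x : ℝ | 1 < x ∧ f x = 0}.Infinite := by
  intro hfin
  obtain ⟨X, hX⟩ := hfin.bddAbove
  have hne : ∀ x, max 1 X < x → f x ≠ 0 := by
    intro x hx h0
    have := hX (show x ∈ {x : ℝ | 1 < x ∧ f x = 0} from ⟨(le_max_left _ _).trans_lt hx, h0⟩)
    exact absurd hx (not_lt.2 (this.trans (le_max_right _ _)))
  have hcont : ContinuousOn f (Ioi (max 1 X)) := fun x _ => (hf x).continuousAt.continuousWithinAt
  have hpre : IsPreconnected (Ioi (max 1 X)) := isPreconnected_Ioi
  have hsign : (∀ x ∈ Ioi (max 1 X), 0 < f x) ∨ (∀ x ∈ Ioi (max 1 X), f x < 0) := by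
    by_contra hcon
    push Not at hcon
    obtain ⟨⟨x, hx, hx0⟩, ⟨y, hy, hy0⟩⟩ := hcon
    obtain ⟨w, hw, hw0⟩ := hpre.intermediate_value hx hy hcont ⟨hx0, hy0⟩
    exact hne w hw hw0
  rcases hsign with h | h
  · exact sturm_pos c χ _ hc f hf hode h
  · refine sturm_pos c χ (max 1 X) hc (fun x => - f x) (fun x => (hf x).neg) (fun x => ?_)
      (fun x hx => neg_pos.2 (h x hx))
    have e1 : deriv (fun x => - f x) = fun x => - deriv f x := by ext x; exact deriv.fun_neg
    rw [e1, deriv.fun_neg]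
    linarith [hode x]

lemma bandT_symm (c : ℝ) (f g : ℝ → ℂ) (hf : Continuous f) (hg : Continuous g) :
    ∫ x in (-1:ℝ)..1, bandT c g x * f x = ∫ t in (-1:ℝ)..1, g t * bandT c f t := by
  have h1 : ∀ x, bandT c g x * f x =
      ∫ t in (-1:ℝ)..1, g t * f x * Complex.exp (Complex.I * (c:ℂ) * (x:ℂ) * (t:ℂ)) := by
    intro x
    rw [bandT, ← intervalIntegral.integral_mul_const]
    congr with t; ring
  have h2 : ∀ t, g t * bandT c f t =
      ∫ x in (-1:ℝ)..1, g t * f x * Complex.exp (Complex.I * (c:ℂ) * (x:ℂ) * (t:ℂ)) := by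
    intro t
    rw [bandT, ← intervalIntegral.integral_const_mul]
    congr with x
    rw [show Complex.I * (c:ℂ) * (t:ℂ) * (x:ℂ) = Complex.I * (c:ℂ) * (x:ℂ) * (t:ℂ) by ring]
    ring
  simp_rw [h1, h2]
  apply intervalIntegral_intervalIntegral_swap
  rw [uIoc_of_le (by norm_num)]
  refine IntegrableOn.mono_set ?_ (Set.prod_mono Ioc_subset_Icc_self Ioc_subset_Icc_self)
  refine ContinuousOn.integrableOn_compact (isCompact_Icc.prod isCompact_Icc) ?_
  apply Continuous.continuousOn
  simp only [Function.uncurry_def]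
  fun_prop

/-- Dividing out a zero stays band-limited. -/
lemma exists_quotient (c : ℝ) (f : ℝ → ℂ) (hf : Continuous f) (w : ℂ)
    (hw : ∫ t in (-1:ℝ)..1, f t * Complex.exp (Complex.I * (c:ℂ) * w * (t:ℂ)) = 0) :
    ∃ h : ℝ → ℂ, Continuous h ∧ ∀ x : ℝ, bandT c f x = -(Complex.I * c * (x - w)) * bandT c h x := by
  let φ : ℝ → ℂ := fun t => f t * Complex.exp (Complex.I * (c:ℂ) * w * (t:ℂ))
  have hφ : Continuous φ := by fun_prop
  let G : ℝ → ℂ := fun t => ∫ s in (-1:ℝ)..t, φ s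
  have hG : ∀ t, HasDerivAt G (φ t) t := fun t => hφ.integral_hasStrictDerivAt (-1) t |>.hasDerivAt
  have hGc : Continuous G := continuous_iff_continuousAt.2 fun t => (hG t).continuousAt
  have hG1 : G 1 = 0 := hw
  have hG0 : G (-1) = 0 := intervalIntegral.integral_same
  refine ⟨fun t => G t * Complex.exp (-(Complex.I * (c:ℂ) * w * (t:ℂ))), by fun_prop, fun x => ?_⟩
  have hE : ∀ t : ℝ, HasDerivAt (fun t : ℝ => Complex.exp (Complex.I * c * (x - w) * (t:ℂ)))
      (Complex.exp (Complex.I * c * (x - w) * (t:ℂ)) * (Complex.I * c * (x - w))) t := by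
    intro t
    have h1 : HasDerivAt (fun t : ℝ => Complex.I * c * (x - w) * (t:ℂ)) (Complex.I * c * (x - w)) t := by
      simpa using (Complex.ofRealCLM.hasDerivAt (x := t)).const_mul (Complex.I * c * (x - w))
    exact h1.cexp
  have key := intervalIntegral.integral_deriv_mul_eq_sub (a := -1) (b := 1) (fun t _ => hG t) (fun t _ => hE t)
    (hφ.intervalIntegrable _ _) (Continuous.intervalIntegrable (by fun_prop) _ _)
  rw [hG1, hG0, intervalIntegral.integral_add] at key
  · have e1 : ∫ t in (-1:ℝ)..1, φ t * Complex.exp (Complex.I * c * (x - w) * (t:ℂ)) = bandT c f x := by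
      rw [bandT]
      congr with t
      simp only [φ]
      rw [mul_assoc, ← Complex.exp_add]
      congr 2; ring
    have e2 : ∫ t in (-1:ℝ)..1, G t * (Complex.exp (Complex.I * c * (x - w) * (t:ℂ)) * (Complex.I * c * (x - w)))
        = (Complex.I * c * (x - w)) * bandT c (fun t => G t * Complex.exp (-(Complex.I * (c:ℂ) * w * (t:ℂ)))) x := by
      rw [bandT, ← intervalIntegral.integral_const_mul]
      congr with t
      rw [mul_assoc (G t), ← Complex.exp_add, 
        show -(Complex.I * (c:ℂ) * w * (t:ℂ)) + Complex.I * (c:ℂ) * (x:ℂ) * (t:ℂ) = Complex.I * c * (x - w) * (t:ℂ) by ring]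
      ring
    rw [e1, e2] at key
    linear_combination key
  · exact Continuous.intervalIntegrable (by fun_prop) _ _
  · exact Continuous.intervalIntegrable (by fun_prop) _ _

lemma exists_ne_zero (f : ℝ → ℝ) (hf : ∀ x : ℝ, AnalyticAt ℝ f x)
    (hn : ∫ t in (-1:ℝ)..1, (f t)^2 = 1) (a b : ℝ) (hab : a < b) : ∃ x ∈ Ioo a b, f x ≠ 0 := by
  by_contra hcon
  push Not at hcon
  have hA : AnalyticOnNhd ℝ f univ := fun z _ => hf z
  have : f = fun _ => 0 := by
    apply hA.eq_of_eventuallyEq (z₀ := (a+b)/2) (fun z _ => analyticAt_const)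
    filter_upwards [Ioo_mem_nhds (show a < (a+b)/2 by linarith) (show (a+b)/2 < b by linarith)] with x hx
    exact hcon x hx
  rw [this] at hn
  simp at hn

lemma zeros_real (c : ℝ) (hc : 0 < c) (f : ℝ → ℝ) (hf : ∀ x : ℝ, AnalyticAt ℝ f x)
    (hn : ∫ t in (-1:ℝ)..1, (f t)^2 = 1) (lam : ℂ) (hlam : lam ≠ 0)
    (heig : ∀ x : ℝ, lam * (f x : ℂ) = bandT c (fun t => (f t : ℂ)) x) (w : ℂ)
    (hw : ∫ t in (-1:ℝ)..1, (f t : ℂ) * Complex.exp (Complex.I * (c:ℂ) * w * (t:ℂ)) = 0) :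
    w.im = 0 := by
  by_contra hb
  have hfc : Continuous f := continuous_iff_continuousAt.2 fun x => (hf x).continuousAt
  have hfc' : Continuous (fun t => (f t : ℂ)) := by fun_prop
  obtain ⟨h, hh, hq⟩ := exists_quotient c _ hfc' w hw
  have hxw : ∀ x : ℝ, (x:ℂ) - w ≠ 0 := by
    intro x hx
    apply hb
    have := congrArg Complex.im hx
    simpa using this
  have hc' : (c:ℂ) ≠ 0 := by exact_mod_cast hc.ne'
  have hbh : ∀ x : ℝ, bandT c h x = -(lam / (Complex.I * c)) * ((f x : ℂ) / (x - w)) := by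
    intro x
    have := hq x
    rw [← heig] at this
    have h1 := hxw x
    have h2 := Complex.I_ne_zero
    field_simp
    linear_combination this
  set L : ℝ := Complex.normSq lam with hL
  set M : ℝ := 2 * π / c with hM
  have hLpos : 0 < L := Complex.normSq_pos.2 hlam
  have hLc : (L:ℂ) = lam * star lam := by
    rw [hL, ← Complex.mul_conj]; rfl
  obtain ⟨p1, p2⟩ := bandT_plancherel c hc _ _ hfc' hfc'
  obtain ⟨-, p3⟩ := bandT_plancherel c hc _ _ hfc' hh
  -- square integrability
  have hsq : Integrable (fun x => (f x)^2) := by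
    have h1 := (p1.integrable_norm_pow (by norm_num)).const_mul (L⁻¹)
    refine h1.congr (Filter.Eventually.of_forall fun x => ?_)
    simp only [← heig, norm_mul, mul_pow]
    rw [hL, Complex.normSq_eq_norm_sq]
    have : ‖lam‖ ≠ 0 := norm_ne_zero_iff.2 hlam
    simp
    field_simp
  -- identity for f^2
  have id0 : L * ∫ x, (f x)^2 = M * ∫ x in (-1:ℝ)..1, (f x)^2 := by
    have e1 : ∫ x, bandT c (fun t => (f t : ℂ)) x * star (bandT c (fun t => (f t : ℂ)) x)
        = ((L * ∫ x, (f x)^2 : ℝ) : ℂ) := by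
      push_cast
      rw [← integral_complex_ofReal, ← integral_const_mul]
      congr with x
      rw [← heig, hLc]
      simp
      ring
    have e2 : ∫ t in (-1:ℝ)..1, (f t : ℂ) * star (f t : ℂ) = ((∫ x in (-1:ℝ)..1, (f x)^2 : ℝ) : ℂ) := by
      rw [← intervalIntegral.integral_ofReal]
      congr with x
      simp
      ring
    rw [e1, e2] at p2
    exact_mod_cast p2
  let K : ℝ → ℂ := fun x => (f x : ℂ)^2 / (x - w)
  have idK : (L:ℂ) * ∫ x, K x = (M:ℂ) * ∫ x in (-1:ℝ)..1, K x := by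
    have s := bandT_symm c _ _ hfc' hh
    have e1 : ∫ x, bandT c h x * star (bandT c (fun t => (f t : ℂ)) x)
        = -(1 / (Complex.I * c)) * (L * ∫ x, K x) := by
      rw [← integral_const_mul, ← integral_const_mul]
      congr with x
      rw [hbh, ← heig, hLc]
      simp only [K, star_mul, Complex.star_def, Complex.conj_ofReal]
      ring
    have e2 : ∫ t in (-1:ℝ)..1, h t * star (f t : ℂ) = ∫ t in (-1:ℝ)..1, h t * (f t : ℂ) := by
      congr with x
      simp
    have e3 : ∫ x in (-1:ℝ)..1, bandT c h x * (f x : ℂ) = lam * (-(1 / (Complex.I * c)) * ∫ x in (-1:ℝ)..1, K x) := by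
      rw [← intervalIntegral.integral_const_mul, ← intervalIntegral.integral_const_mul]
      congr with x
      rw [hbh]
      simp only [K, star_mul, Complex.star_def, Complex.conj_ofReal]
      ring
    have e4 : ∫ t in (-1:ℝ)..1, h t * bandT c (fun t => (f t : ℂ)) t = lam * ∫ t in (-1:ℝ)..1, h t * (f t : ℂ) := by
      rw [← intervalIntegral.integral_const_mul]
      congr with x
      rw [← heig]
      ring
    rw [e3, e4] at s
    have s' := mul_left_cancel₀ hlam s
    rw [e1, e2, ← s'] at p3
    have h2 : -(1 / (Complex.I * c)) ≠ 0 := by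
      apply neg_ne_zero.2
      exact one_div_ne_zero (mul_ne_zero Complex.I_ne_zero hc')
    apply mul_left_cancel₀ h2
    rw [p3]
    ring
  have hKc : Continuous K := by
    apply Continuous.div (by fun_prop) (by fun_prop) hxw
  have hKint : Integrable K := by
    refine (hsq.const_mul |w.im|⁻¹).mono' hKc.aestronglyMeasurable (Filter.Eventually.of_forall fun x => ?_)
    have h1 : |w.im| ≤ ‖(x:ℂ) - w‖ := by
      have := Complex.abs_im_le_norm ((x:ℂ) - w)
      simpa using this
    have h0 : 0 < |w.im| := abs_pos.2 hb
    simp only [K, norm_div, norm_pow, Complex.norm_real, Real.norm_eq_abs, sq_abs]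
    rw [mul_comm, ← div_eq_mul_inv]
    gcongr
  let R : ℝ → ℝ := fun x => (K x).re
  let S : ℝ → ℝ := fun x => (K x).im
  have hRint : Integrable R := hKint.re
  have hSint : Integrable S := hKint.im
  have idR : L * ∫ x, R x = M * ∫ x in (-1:ℝ)..1, R x := by
    have h1 := congrArg Complex.re idK
    rw [Complex.re_ofReal_mul, Complex.re_ofReal_mul] at h1
    have h2 : ∫ x, R x = (∫ x, K x).re := integral_re hKint
    have h3 : ∫ x in (-1:ℝ)..1, R x = (∫ x in (-1:ℝ)..1, K x).re := by
      rw [intervalIntegral.integral_of_le (by norm_num), intervalIntegral.integral_of_le (by norm_num)]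
      exact integral_re hKint.integrableOn
    rw [h2, h3, h1]
  have idS : L * ∫ x, S x = M * ∫ x in (-1:ℝ)..1, S x := by
    have h1 := congrArg Complex.im idK
    rw [Complex.im_ofReal_mul, Complex.im_ofReal_mul] at h1
    have h2 : ∫ x, S x = (∫ x, K x).im := integral_im hKint
    have h3 : ∫ x in (-1:ℝ)..1, S x = (∫ x in (-1:ℝ)..1, K x).im := by
      rw [intervalIntegral.integral_of_le (by norm_num), intervalIntegral.integral_of_le (by norm_num)]
      exact integral_im hKint.integrableOn
    rw [h2, h3, h1]
  let N : ℝ → ℝ := fun x => (x - w.re)^2 + w.im^2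
  have hNpos : ∀ x, 0 < N x := fun x => by
    have : 0 < w.im^2 := by positivity
    have := sq_nonneg (x - w.re)
    simp only [N]; linarith
  have hKform : ∀ x, K x = (((f x)^2 * (x - w.re) / N x : ℝ) : ℂ) + (((f x)^2 * w.im / N x : ℝ) : ℂ) * Complex.I := by
    intro x
    have h1 : ((N x : ℝ) : ℂ) = (x - w) * (x - (starRingEnd ℂ) w) := by
      apply Complex.ext <;> simp [N, pow_two] <;> ring
    have h2 : (x:ℂ) - (starRingEnd ℂ) w = (x - w.re : ℝ) + (w.im : ℝ) * Complex.I := by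
      apply Complex.ext <;> simp
    have h3 : ((N x : ℝ) : ℂ) ≠ 0 := by exact_mod_cast (hNpos x).ne'
    have h4 : K x = (f x : ℂ)^2 * ((x:ℂ) - (starRingEnd ℂ) w) / (N x : ℝ) := by
      simp only [K]
      rw [div_eq_div_iff (hxw x) h3, h1]; ring
    rw [h4, h2]
    push_cast
    ring
  have hR : ∀ x, R x = (f x)^2 * (x - w.re) / N x := fun x => by
    simp only [R]; rw [hKform x, Complex.add_re, Complex.ofReal_re, Complex.re_ofReal_mul, Complex.I_re]; ring
  have hS : ∀ x, S x = (f x)^2 * w.im / N x := fun x => by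
    simp only [S]; rw [hKform x, Complex.add_im, Complex.ofReal_im, Complex.im_ofReal_mul, Complex.I_im]; ring
  have hNc : Continuous N := by fun_prop
  let q1 : ℝ → ℝ := fun x => (f x)^2 / N x
  have hq1S : ∀ x, q1 x = (w.im)⁻¹ * S x := fun x => by
    rw [hS]; simp only [q1]; field_simp
  have hq1c : Continuous q1 := (hfc.pow 2).div hNc fun x => (hNpos x).ne'
  have hq1int : Integrable q1 := by
    rw [show q1 = fun x => (w.im)⁻¹ * S x from funext hq1S]; exact hSint.const_mul _
  have hq1nn : ∀ x, 0 ≤ q1 x := fun x => div_nonneg (sq_nonneg _) (hNpos x).le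
  have id1 : L * ∫ x, q1 x = M * ∫ x in (-1:ℝ)..1, q1 x := by
    simp_rw [hq1S]
    rw [integral_const_mul, intervalIntegral.integral_const_mul]
    linear_combination (w.im)⁻¹ * idS
  let q : ℝ → ℝ := fun x => (1 - x^2) * q1 x
  have hqf : ∀ x, q x = ((1 - w.re^2 + w.im^2) * q1 x - 2 * w.re * R x) - (f x)^2 := fun x => by
    have h1 : (f x)^2 = q1 x * N x := by
      simp only [q1]; have := (hNpos x).ne'; field_simp
    have h2 : R x = q1 x * (x - w.re) := by
      rw [hR]; simp only [q1]; ring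
    rw [h1, h2]; simp only [q, N]; ring
  have hqc : Continuous q := by fun_prop
  have hqint : Integrable q := by
    rw [show q = fun x => ((1 - w.re^2 + w.im^2) * q1 x - 2 * w.re * R x) - (f x)^2 from funext hqf]
    exact ((hq1int.const_mul _).sub (hRint.const_mul _)).sub hsq
  have idq : L * ∫ x, q x = M * ∫ x in (-1:ℝ)..1, q x := by
    simp_rw [hqf]
    have i1 : Integrable (fun x => (1 - w.re^2 + w.im^2) * q1 x) := hq1int.const_mul _
    have i2 : Integrable (fun x => 2 * w.re * R x) := hRint.const_mul _
    have i3 : Integrable (fun x => (1 - w.re^2 + w.im^2) * q1 x - 2 * w.re * R x) := i1.sub i2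
    rw [integral_sub i3 hsq, integral_sub i1 i2, integral_const_mul, integral_const_mul,
      intervalIntegral.integral_sub i3.intervalIntegrable hsq.intervalIntegrable,
      intervalIntegral.integral_sub i1.intervalIntegrable i2.intervalIntegrable,
      intervalIntegral.integral_const_mul, intervalIntegral.integral_const_mul]
    linear_combination (1 - w.re^2 + w.im^2) * id1 - 2 * w.re * idR - id0
  -- M > L
  have hI1 : 0 < ∫ x in (-1:ℝ)..1, q1 x := by
    obtain ⟨x, hx, hx0⟩ := exists_ne_zero f hf hn (-1) 1 (by norm_num)
    exact intervalIntegral.integral_pos (by norm_num) hq1c.continuousOn (fun x _ => hq1nn x)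
      ⟨x, Ioo_subset_Icc_self hx, div_pos (by positivity) (hNpos x)⟩
  have hI2 : 0 < ∫ x in (1:ℝ)..2, q1 x := by
    obtain ⟨x, hx, hx0⟩ := exists_ne_zero f hf hn 1 2 (by norm_num)
    exact intervalIntegral.integral_pos (by norm_num) hq1c.continuousOn (fun x _ => hq1nn x)
      ⟨x, Ioo_subset_Icc_self hx, div_pos (by positivity) (hNpos x)⟩
  have hlt : ∫ x in (-1:ℝ)..1, q1 x < ∫ x, q1 x := by
    have h1 : ∫ x in (-1:ℝ)..2, q1 x ≤ ∫ x, q1 x := by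
      rw [intervalIntegral.integral_of_le (by norm_num)]
      exact setIntegral_le_integral hq1int (Filter.Eventually.of_forall hq1nn)
    have h2 := intervalIntegral.integral_add_adjacent_intervals
      (hq1int.intervalIntegrable (a := -1) (b := 1)) (hq1int.intervalIntegrable (a := 1) (b := 2))
    linarith
  have hML : L < M := by
    by_contra hcon
    push Not at hcon
    nlinarith
  have hA : 0 < ∫ x in (-1:ℝ)..1, q x := by
    obtain ⟨x, hx, hx0⟩ := exists_ne_zero f hf hn (-1) 1 (by norm_num)
    refine intervalIntegral.integral_pos (by norm_num) hqc.continuousOn (fun x hx => ?_)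
      ⟨x, Ioo_subset_Icc_self hx, ?_⟩
    · exact mul_nonneg (by nlinarith [hx.1, hx.2]) (hq1nn x)
    · exact mul_pos (by nlinarith [hx.1, hx.2]) (div_pos (by positivity) (hNpos x))
  have hle : ∫ x, q x ≤ ∫ x in (-1:ℝ)..1, q x := by
    rw [intervalIntegral.integral_of_le (by norm_num),
      ← integral_add_compl measurableSet_Ioc hqint]
    have : ∫ x in (Ioc (-1:ℝ) 1)ᶜ, q x ≤ 0 := by
      apply setIntegral_nonpos measurableSet_Ioc.compl
      intro x hx
      refine mul_nonpos_of_nonpos_of_nonneg ?_ (hq1nn x)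
      rw [mem_compl_iff, mem_Ioc, not_and_or, not_lt, not_le] at hx
      rcases hx with hx | hx <;> nlinarith
    linarith
  nlinarith

theorem psi_analytic_continuation_properties
    (c : ℝ) (hc : 0 < c)
    (n : ℕ)
    (ψn : ℝ → ℝ) (lamn : ℂ) (χn : ℝ)
    (hnd : ProlateDatum c n ψn lamn χn)
    (Ψ : ℂ → ℂ)
    (hΨ : ∀ z : ℂ, Ψ z = lamn⁻¹ *
      ∫ t in (-1:ℝ)..1, (ψn t : ℂ) * Complex.exp (Complex.I * (c:ℂ) * z * (t:ℂ))) :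
    (∀ z : ℂ, Ψ z = 0 → z.im = 0 ∧ deriv Ψ z ≠ 0) ∧
    {x : ℝ | 1 < x ∧ Ψ (x:ℂ) = 0}.Infinite ∧
    (∀ z : ℂ, (1 - z^2) * deriv (deriv Ψ) z - 2*z * deriv Ψ z
      + ((χn:ℂ) - (c:ℂ)^2 * z^2) * Ψ z = 0) := by
  have hcont : Continuous ψn := continuous_iff_continuousAt.2 fun x => (hnd.analytic x).continuousAt
  have hΨd : Differentiable ℂ Ψ := by
    rw [show Ψ = _ from funext hΨ]
    exact (bandC_differentiable c (fun t => (ψn t : ℂ)) (by fun_prop)).const_mul _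
  have hΨr : ∀ x : ℝ, Ψ x = ψn x := by
    intro x
    rw [hΨ, ← hnd.integral_eig x, inv_mul_cancel_left₀ hnd.lam_ne_zero]
  have hode := ode_ext c χn Ψ ψn hΨd hΨr hnd.analytic hnd.diff_eq
  refine ⟨fun z hz => ⟨?_, ?_⟩, ?_, hode⟩
  · refine zeros_real c hc ψn hnd.analytic hnd.normalized lamn hnd.lam_ne_zero hnd.integral_eig z ?_
    rw [hΨ] at hz
    exact (mul_eq_zero.1 hz).resolve_left (inv_ne_zero hnd.lam_ne_zero)
  · refine simple_zeros c χn Ψ hΨd hode ?_ z hz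
    obtain ⟨x, -, hx⟩ := exists_ne_zero ψn hnd.analytic hnd.normalized 0 1 one_pos
    exact ⟨x, by rw [hΨr]; exact_mod_cast hx⟩
  · have := infinite_zeros c χn hc ψn hnd.analytic hnd.diff_eq
    simpa [hΨr] using this
end

section
/- Let c > 0 be a real number, let χ be a real number, and let ψ : [−1,1] → ℝ be a continuous function, not identically zero, which is twice continuously differentiable on (−1,1) and satisfies (1−x²)·ψ''(x) − 2x·ψ'(x) + (χ − c²·x²)·ψ(x) = 0 for all x in (−1,1). Then ψ is an eigenfunction of the prolate integral operator: there exists a nonzero complex number λ such that λ·ψ(x) = ∫_{-1}^{1} ψ(t)·exp(i·c·x·t) dt for all x in [−1,1]. -/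
open Real MeasureTheory Set

/-- a continuous function has no logarithmic singularity -/
lemma aux_lim_zero (f d : ℝ → ℝ) (hf : Continuous f)
    (hd : ∀ x ∈ Ioo (-1:ℝ) 1, HasDerivAt f (d x) x) (p : ℝ → ℝ) (hp : Continuous p)
    (hpd : ∀ x ∈ Ioo (-1:ℝ) 1, (1 - x^2) * d x = p x) : p 1 = 0 := by
  by_contra hL
  have h1 : ∀ᶠ x in nhds (1:ℝ), |p 1| / 2 < |p x| := by
    have : Filter.Tendsto (fun x => |p x|) (nhds 1) (nhds |p 1|) :=
      (hp.abs).continuousAt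
    exact this.eventually (lt_mem_nhds (by have := abs_pos.mpr hL; linarith))
  have h2 : ∀ᶠ x in nhds (1:ℝ), |f x - f 1| < |p 1| / 32 := by
    have : Filter.Tendsto (fun x => |f x - f 1|) (nhds 1) (nhds |f 1 - f 1|) :=
      ((hf.sub continuous_const).abs).continuousAt
    exact this.eventually (gt_mem_nhds (by rw [sub_self, abs_zero]; have := abs_pos.mpr hL; linarith))
  obtain ⟨ε, hε, hball⟩ := Metric.eventually_nhds_iff.mp (h1.and h2)
  set δ := min (ε / 2) (1 / 2) with hδ
  have hδ0 : 0 < δ := by positivity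
  have hδ1 : δ ≤ 1 / 2 := min_le_right _ _
  have hδε : δ < ε := lt_of_le_of_lt (min_le_left _ _) (by linarith)
  obtain ⟨ξ, hξ, hs⟩ := exists_hasDerivAt_eq_slope f d (a := 1 - δ) (b := 1 - δ / 2) (by linarith)
    hf.continuousOn (fun x hx => hd x ⟨by linarith [hx.1], by linarith [hx.2]⟩)
  have e : (1 - δ / 2 - (1 - δ)) = δ / 2 := by ring
  rw [e] at hs
  have hξ1 := hξ.1
  have hξ2 := hξ.2
  have hpx := hpd ξ ⟨by linarith, by linarith⟩
  have k1 := (hball (y := ξ) (by rw [Real.dist_eq, abs_lt]; constructor <;> linarith)).1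
  have k2 := (hball (y := 1 - δ) (by rw [Real.dist_eq, abs_lt]; constructor <;> linarith)).2
  have k3 := (hball (y := 1 - δ / 2) (by rw [Real.dist_eq, abs_lt]; constructor <;> linarith)).2
  have k4 : |f (1 - δ / 2) - f (1 - δ)| < |p 1| / 16 := by
    rw [abs_lt] at *
    constructor <;> linarith [k2.1, k2.2, k3.1, k3.2]
  have hs' : f (1 - δ / 2) - f (1 - δ) = d ξ * (δ / 2) := by
    rw [hs]; field_simp
  rw [hs', abs_mul, abs_of_pos (by linarith : 0 < δ / 2)] at k4
  rw [← hpx, abs_mul, abs_of_pos (by nlinarith : 0 < 1 - ξ ^ 2)] at k1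
  have : (1 - ξ^2) ≤ 2 * δ := by nlinarith
  have := mul_le_mul_of_nonneg_right this (abs_nonneg (d ξ))
  have := abs_pos.mpr hL
  nlinarith

/-- differentiation under the integral -/
lemma aux_param (c : ℝ) (φ : ℝ → ℂ) (hφ : Continuous φ) (x : ℝ) :
    HasDerivAt (fun x : ℝ => ∫ t in (-1:ℝ)..1, φ t * Complex.exp (Complex.I * (c:ℂ) * (x:ℂ) * (t:ℂ)))
      (∫ t in (-1:ℝ)..1, (φ t * (Complex.I * c * t)) *
        Complex.exp (Complex.I * (c:ℂ) * (x:ℂ) * (t:ℂ))) x := by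
  have hn : ∀ x t : ℝ, ‖Complex.exp (Complex.I * (c:ℂ) * (x:ℂ) * (t:ℂ))‖ = 1 := by
    intro x t
    rw [show Complex.I * (c:ℂ) * (x:ℂ) * (t:ℂ) = ((c * x * t : ℝ) : ℂ) * Complex.I by
      push_cast; ring]
    exact Complex.norm_exp_ofReal_mul_I _
  refine (intervalIntegral.hasDerivAt_integral_of_dominated_loc_of_deriv_le (s := univ)
    (F' := fun (x t : ℝ) => (φ t * (Complex.I * c * t)) *
        Complex.exp (Complex.I * (c:ℂ) * (x:ℂ) * (t:ℂ)))
    (bound := fun t => ‖φ t * (Complex.I * c * t)‖) Filter.univ_mem ?_ ?_ ?_ ?_ ?_ ?_).2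
  · exact Filter.Eventually.of_forall fun y => Continuous.aestronglyMeasurable (by fun_prop)
  · exact Continuous.intervalIntegrable (by fun_prop) _ _
  · exact Continuous.aestronglyMeasurable (by fun_prop)
  · refine Filter.Eventually.of_forall fun t _ y _ => ?_
    rw [norm_mul, hn, mul_one]
  · exact Continuous.intervalIntegrable (by fun_prop) _ _
  · refine Filter.Eventually.of_forall fun t _ y _ => ?_
    have h1 : HasDerivAt (fun y : ℝ => Complex.I * (c:ℂ) * (y:ℂ) * (t:ℂ)) (Complex.I * c * t) y := by
      have := ((Complex.ofRealCLM.hasDerivAt (x := y)).const_mul (Complex.I * (c:ℂ))).mul_const (t:ℂ)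
      simpa using this
    have := (h1.cexp).const_mul (φ t)
    refine this.congr_deriv ?_
    ring

/-- vanishing transform forces vanishing function -/
lemma aux_inj (c : ℝ) (hc : 0 < c) (f : ℝ → ℝ) (hf : Continuous f)
    (h : ∀ x ∈ Ioo (-1:ℝ) 1, ∫ t in (-1:ℝ)..1, (f t : ℂ) *
      Complex.exp (Complex.I * (c:ℂ) * (x:ℂ) * (t:ℂ)) = 0) :
    ∀ x ∈ Icc (-1:ℝ) 1, f x = 0 := by
  have hm : ∀ n : ℕ, ∀ x ∈ Ioo (-1:ℝ) 1, ∫ t in (-1:ℝ)..1, ((f t : ℂ) * (Complex.I * c * t) ^ n) *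
      Complex.exp (Complex.I * (c:ℂ) * (x:ℂ) * (t:ℂ)) = 0 := by
    intro n
    induction n with
    | zero => simpa using h
    | succ n ih =>
      intro x hx
      have h1 := aux_param c (fun t => (f t : ℂ) * (Complex.I * c * t) ^ n) (by fun_prop) x
      have h2 : HasDerivAt (fun x : ℝ => ∫ t in (-1:ℝ)..1, ((f t : ℂ) * (Complex.I * c * t) ^ n) *
        Complex.exp (Complex.I * (c:ℂ) * (x:ℂ) * (t:ℂ))) 0 x := by
        refine (hasDerivAt_const x (0:ℂ)).congr_of_eventuallyEq ?_
        filter_upwards [isOpen_Ioo.mem_nhds hx] with y hy using ih y hy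
      have := h1.unique h2
      simpa only [pow_succ, mul_assoc] using this
  have hmom : ∀ n : ℕ, ∫ t in (-1:ℝ)..1, f t * t ^ n = 0 := by
    intro n
    have h0 := hm n 0 (by norm_num)
    have e : ∀ t : ℝ, ((f t : ℂ) * (Complex.I * c * t) ^ n) *
      Complex.exp (Complex.I * (c:ℂ) * ((0:ℝ):ℂ) * (t:ℂ)) =
        (Complex.I * c) ^ n * ((f t * t ^ n : ℝ) : ℂ) := by
      intro t; push_cast; simp; ring
    simp only [e] at h0
    rw [intervalIntegral.integral_const_mul, intervalIntegral.integral_ofReal] at h0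
    have : (Complex.I * (c:ℂ)) ^ n ≠ 0 :=
      pow_ne_zero _ (mul_ne_zero Complex.I_ne_zero (by exact_mod_cast hc.ne'))
    exact_mod_cast (mul_eq_zero.mp h0).resolve_left this
  have hpoly : ∀ q : Polynomial ℝ, ∫ t in (-1:ℝ)..1, f t * q.eval t = 0 := by
    intro q
    induction q using Polynomial.induction_on' with
    | add p q hp hq =>
      simp only [Polynomial.eval_add, mul_add]
      rw [intervalIntegral.integral_add, hp, hq, add_zero]
      · exact Continuous.intervalIntegrable (by fun_prop) _ _
      · exact Continuous.intervalIntegrable (by fun_prop) _ _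
    | monomial n a =>
      simp only [Polynomial.eval_monomial]
      have : ∀ t, f t * (a * t ^ n) = a * (f t * t ^ n) := fun t => by ring
      simp only [this]
      rw [intervalIntegral.integral_const_mul, hmom, mul_zero]
  have hsq : ∫ t in (-1:ℝ)..1, f t * f t ≤ 0 := by
    set A := ∫ t in (-1:ℝ)..1, |f t| with hA
    have hA0 : 0 ≤ A := intervalIntegral.integral_nonneg (by norm_num) fun _ _ => abs_nonneg _
    refine le_of_forall_pos_le_add fun ε hε => ?_
    obtain ⟨q, hq⟩ := exists_polynomial_near_of_continuousOn (-1) 1 f hf.continuousOn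
      (ε / (A + 1)) (by positivity)
    have : ∫ t in (-1:ℝ)..1, f t * f t = ∫ t in (-1:ℝ)..1, (f t * f t - f t * q.eval t) := by
      rw [intervalIntegral.integral_sub, hpoly, sub_zero]
      · exact Continuous.intervalIntegrable (by fun_prop) _ _
      · exact Continuous.intervalIntegrable (by fun_prop) _ _
    rw [this]
    calc _ ≤ ∫ t in (-1:ℝ)..1, (ε / (A + 1)) * |f t| := by
          apply intervalIntegral.integral_mono_on (by norm_num)
          · exact Continuous.intervalIntegrable (by fun_prop) _ _
          · exact Continuous.intervalIntegrable (by fun_prop) _ _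
          · intro t ht
            have h3 := hq t ht
            rw [abs_sub_comm] at h3
            calc _ ≤ |f t * f t - f t * q.eval t| := le_abs_self _
              _ = |f t - q.eval t| * |f t| := by rw [← abs_mul]; congr 1; ring
              _ ≤ _ := by gcongr
      _ = (ε / (A + 1)) * A := by rw [intervalIntegral.integral_const_mul]
      _ ≤ 0 + ε := by
        rw [zero_add, div_mul_eq_mul_div, div_le_iff₀ (by positivity)]
        nlinarith
  by_contra hcon
  push Not at hcon
  obtain ⟨x, hx, hfx⟩ := hcon
  have : 0 < ∫ t in (-1:ℝ)..1, f t * f t := by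
    apply intervalIntegral.integral_pos (by norm_num)
    · fun_prop
    · intro t _; exact mul_self_nonneg _
    · exact ⟨x, hx, mul_self_pos.mpr hfx⟩
  nlinarith

/-- the weighted derivative extends continuously with vanishing boundary values -/
lemma aux_P (c χ : ℝ) (f d : ℝ → ℝ) (hf : Continuous f)
    (hd : ∀ x ∈ Ioo (-1:ℝ) 1, HasDerivAt f (d x) x)
    (hd2 : ∀ x ∈ Ioo (-1:ℝ) 1, HasDerivAt (fun x => (1 - x^2) * d x) ((c^2 * x^2 - χ) * f x) x) :
    ∃ P : ℝ → ℝ, Continuous P ∧ (∀ x, HasDerivAt P ((c^2 * x^2 - χ) * f x) x) ∧ P (-1) = 0 ∧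
      P 1 = 0 ∧ ∀ x ∈ Ioo (-1:ℝ) 1, (1 - x^2) * d x = P x := by
  have hcont : Continuous fun x => (c^2 * x^2 - χ) * f x := by fun_prop
  set Q : ℝ → ℝ := fun x => ∫ t in (0:ℝ)..x, (c^2 * t^2 - χ) * f t with hQ
  have hQd : ∀ x, HasDerivAt Q ((c^2 * x^2 - χ) * f x) x := fun x =>
    intervalIntegral.integral_hasDerivAt_right (hcont.intervalIntegrable _ _)
      hcont.stronglyMeasurable.stronglyMeasurableAtFilter hcont.continuousAt
  have hPd : ∀ x, HasDerivAt (fun x => Q x + d 0) ((c^2 * x^2 - χ) * f x) x := fun x =>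
    (hQd x).add_const _
  have hPc : Continuous (fun x => Q x + d 0) :=
    continuous_iff_continuousAt.mpr fun x => (hPd x).continuousAt
  have heq : ∀ x ∈ Ioo (-1:ℝ) 1, (1 - x^2) * d x = Q x + d 0 := by
    intro x hx
    have key : EqOn (fun x => (1 - x^2) * d x) (fun x => Q x + d 0) (Ioo (-1:ℝ) 1) := by
      refine isOpen_Ioo.eqOn_of_deriv_eq isPreconnected_Ioo
        (fun y hy => (hd2 y hy).differentiableAt.differentiableWithinAt)
        (fun y hy => (hPd y).differentiableAt.differentiableWithinAt)
        (fun y hy => (hd2 y hy).deriv.trans (hPd y).deriv.symm)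
        (x := 0) (by norm_num) ?_
      simp [hQ]
    exact key hx
  refine ⟨fun x => Q x + d 0, hPc, hPd, ?_, ?_, heq⟩
  · have := aux_lim_zero (fun x => f (-x)) (fun x => - d (-x)) (by fun_prop) (fun x hx => by
      have := (hd (-x) ⟨by linarith [hx.2], by linarith [hx.1]⟩).comp x (hasDerivAt_neg x)
      simpa [Function.comp_def] using this) (fun x => -(Q (-x) + d 0))
      ((hPc.comp continuous_neg).neg) (fun x hx => by
        have := heq (-x) ⟨by linarith [hx.2], by linarith [hx.1]⟩
        rw [← this]; ring)
    linarith
  · exact aux_lim_zero f d hf hd _ hPc heq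

lemma aux_main (c : ℝ) (hc : 0 < c) (χ : ℝ) (f d : ℝ → ℝ) (hf : Continuous f)
    (hne : ¬ (∀ x ∈ Icc (-1:ℝ) 1, f x = 0))
    (hd : ∀ x ∈ Ioo (-1:ℝ) 1, HasDerivAt f (d x) x)
    (hd2 : ∀ x ∈ Ioo (-1:ℝ) 1, HasDerivAt (fun x => (1 - x^2) * d x) ((c^2 * x^2 - χ) * f x) x) :
    ∃ lam : ℂ, lam ≠ 0 ∧ ∀ x ∈ Icc (-1:ℝ) 1,
      lam * (f x : ℂ) =
        ∫ t in (-1:ℝ)..1, (f t : ℂ) * Complex.exp (Complex.I * (c:ℂ) * (x:ℂ) * (t:ℂ)) := by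
  obtain ⟨P, hPc, hPd, hPm, hP1, hPeq⟩ := aux_P c χ f d hf hd hd2
  set G : ℝ → ℂ := fun x => ∫ t in (-1:ℝ)..1, (f t : ℂ) *
    Complex.exp (Complex.I * (c:ℂ) * (x:ℂ) * (t:ℂ)) with hG
  set G1 : ℝ → ℂ := fun x => ∫ t in (-1:ℝ)..1, ((f t : ℂ) * (Complex.I * c * t)) *
    Complex.exp (Complex.I * (c:ℂ) * (x:ℂ) * (t:ℂ)) with hG1
  set G2 : ℝ → ℂ := fun x => ∫ t in (-1:ℝ)..1, (((f t : ℂ) * (Complex.I * c * t)) *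
    (Complex.I * c * t)) * Complex.exp (Complex.I * (c:ℂ) * (x:ℂ) * (t:ℂ)) with hG2
  have hGd : ∀ x, HasDerivAt G (G1 x) x := fun x => aux_param c (fun t => (f t : ℂ)) (by fun_prop) x
  have hG1d : ∀ x, HasDerivAt G1 (G2 x) x := fun x =>
    aux_param c (fun t => (f t : ℂ) * (Complex.I * c * t)) (by fun_prop) x
  have hfC : ∀ x ∈ Ioo (-1:ℝ) 1, HasDerivAt (fun x => (f x : ℂ)) (d x : ℂ) x :=
    fun x hx => (hd x hx).ofReal_comp
  have hPC : ∀ x : ℝ, HasDerivAt (fun x => (P x : ℂ)) (((c:ℂ)^2 * (x:ℂ)^2 - χ) * f x) x := by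
    intro x
    have := (hPd x).ofReal_comp
    push_cast at this
    exact this
  have hw : ∀ x : ℝ, HasDerivAt (fun x : ℝ => (1 - (x:ℂ)^2)) (-2 * (x:ℂ)) x := by
    intro x
    have := (((hasDerivAt_id x).ofReal_comp).pow 2).const_sub (1:ℂ)
    simpa using this
  have hPeqC : ∀ x ∈ Ioo (-1:ℝ) 1, (1 - (x:ℂ)^2) * d x = P x := by
    intro x hx
    have := hPeq x hx
    exact_mod_cast this
  -- the transform satisfies the differential equation
  have hGode : ∀ x : ℝ, (1 - (x:ℂ)^2) * G2 x - 2 * x * G1 x + (χ - (c:ℂ)^2 * x^2) * G x = 0 := by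
    intro x
    have hK : ∀ t : ℝ, HasDerivAt (fun t : ℝ => Complex.exp (Complex.I * (c:ℂ) * (x:ℂ) * (t:ℂ)))
        (Complex.exp (Complex.I * (c:ℂ) * (x:ℂ) * (t:ℂ)) * (Complex.I * c * x)) t := by
      intro t
      have h1 : HasDerivAt (fun y : ℝ => Complex.I * (c:ℂ) * (x:ℂ) * (y:ℂ)) (Complex.I * c * x) t := by
        have := ((hasDerivAt_id t).ofReal_comp).const_mul (Complex.I * (c:ℂ) * (x:ℂ))
        simpa using this
      exact h1.cexp
    have key := intervalIntegral.integral_eq_sub_of_hasDerivAt_of_le (a := -1) (b := 1)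
      (f := fun t : ℝ => ((1 - (t:ℂ)^2) * f t * (Complex.I * c * x) - P t) *
        Complex.exp (Complex.I * (c:ℂ) * (x:ℂ) * (t:ℂ)))
      (f' := fun t : ℝ => (1 - (x:ℂ)^2) * ((((f t : ℂ) * (Complex.I * c * t)) *
    (Complex.I * c * t)) * Complex.exp (Complex.I * (c:ℂ) * (x:ℂ) * (t:ℂ))) -
      2 * x * (((f t : ℂ) * (Complex.I * c * t)) *
    Complex.exp (Complex.I * (c:ℂ) * (x:ℂ) * (t:ℂ))) + (χ - (c:ℂ)^2 * x^2) * ((f t : ℂ) *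
    Complex.exp (Complex.I * (c:ℂ) * (x:ℂ) * (t:ℂ)))) (by norm_num)
      (Continuous.continuousOn (by fun_prop)) (fun t ht => by
        have h1 := (((((hw t).mul (hfC t ht)).mul_const (Complex.I * c * x)).sub (hPC t)).mul (hK t))
        refine h1.congr_deriv ?_
        have e := hPeqC t ht
        simp only [Pi.mul_apply, Pi.sub_apply]
        rw [← e]
        ring_nf
        simp only [Complex.I_sq]
        ring)
      (Continuous.intervalIntegrable (by fun_prop) _ _)
    rw [intervalIntegral.integral_add, intervalIntegral.integral_sub,
      intervalIntegral.integral_const_mul, intervalIntegral.integral_const_mul,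
      intervalIntegral.integral_const_mul] at key
    · simp only [hG, hG1, hG2]
      rw [key]
      simp [hPm, hP1]
    all_goals exact Continuous.intervalIntegrable (by fun_prop) _ _
  have hGc : Continuous G := continuous_iff_continuousAt.mpr fun x => (hGd x).continuousAt
  have hG1c : Continuous G1 := continuous_iff_continuousAt.mpr fun x => (hG1d x).continuousAt
  have hQd : ∀ x : ℝ, HasDerivAt (fun x : ℝ => (1 - (x:ℂ)^2) * G1 x)
      (((c:ℂ)^2 * (x:ℂ)^2 - χ) * G x) x := by
    intro x
    refine ((hw x).mul (hG1d x)).congr_deriv ?_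
    linear_combination hGode x
  -- Wronskian
  have hW : ∀ x ∈ Icc (-1:ℝ) 1, (1 - (x:ℂ)^2) * G1 x * f x - P x * G x = 0 := by
    intro x hx
    have key := intervalIntegral.integral_eq_sub_of_hasDerivAt_of_le (a := -1) (b := x)
      (f := fun x : ℝ => (1 - (x:ℂ)^2) * G1 x * f x - P x * G x) (f' := fun _ => 0) hx.1
      (Continuous.continuousOn (by fun_prop)) (fun t ht => by
        have ht' : t ∈ Ioo (-1:ℝ) 1 := ⟨ht.1, ht.2.trans_le hx.2⟩
        refine (((hQd t).mul (hfC t ht')).sub ((hPC t).mul (hGd t))).congr_deriv ?_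
        rw [← hPeqC t ht']
        ring) (by simp)
    simpa [hPm] using key.symm
  -- a point where f does not vanish
  obtain ⟨x0, hx0, hfx0⟩ : ∃ x0 ∈ Ioo (-1:ℝ) 1, f x0 ≠ 0 := by
    by_contra hcon
    push Not at hcon
    apply hne
    have : EqOn f (fun _ => 0) (closure (Ioo (-1:ℝ) 1)) :=
      Set.EqOn.closure (fun x hx => hcon x hx) hf continuous_const
    rw [closure_Ioo (by norm_num)] at this
    exact this
  have hfx0C : (f x0 : ℂ) ≠ 0 := by exact_mod_cast hfx0
  set lam : ℂ := G x0 / f x0 with hlam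
  have hGx0 : G x0 = lam * f x0 := by rw [hlam]; field_simp
  have hQx0 : (1 - (x0:ℂ)^2) * G1 x0 = lam * P x0 := by
    have := hW x0 ⟨hx0.1.le, hx0.2.le⟩
    rw [hGx0] at this
    apply mul_right_cancel₀ hfx0C
    linear_combination this
  have hIoo : ∀ x ∈ Ioo (-1:ℝ) 1, lam * f x = G x := by
    intro x hx
    obtain ⟨r, hr, hr1⟩ : ∃ r, max |x0| |x| < r ∧ r < 1 :=
      exists_between (max_lt (abs_lt.mpr hx0) (abs_lt.mpr hx))
    have hr0 : |x0| < r := (le_max_left _ _).trans_lt hr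
    have hrx : |x| < r := (le_max_right _ _).trans_lt hr
    have hrpos : 0 < r := (abs_nonneg _).trans_lt hrx
    have hr2 : 0 < 1 - r^2 := by nlinarith
    let v : ℝ → ℂ × ℂ → ℂ × ℂ := fun t y => (y.2 / (1 - (t:ℂ)^2), ((c:ℂ)^2 * (t:ℂ)^2 - χ) * y.1)
    set K : NNReal := Real.toNNReal (1 / (1 - r^2) + c^2 + |χ|) with hK
    have hKv : (K : ℝ) = 1 / (1 - r^2) + c^2 + |χ| := Real.coe_toNNReal _ (by positivity)
    have hsub : ∀ t ∈ Ioo (-r) r, t ∈ Ioo (-1:ℝ) 1 := fun t ht =>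
      ⟨by linarith [ht.1], by linarith [ht.2]⟩
    have hne1 : ∀ t ∈ Ioo (-1:ℝ) 1, (1 - (t:ℂ)^2) ≠ 0 := by
      intro t ht
      have : (1 - t^2 : ℝ) ≠ 0 := by have := ht.1; have := ht.2; nlinarith
      exact_mod_cast this
    have key := ODE_solution_unique_of_mem_Ioo (v := v) (s := fun _ => univ) (K := K)
      (a := -r) (b := r) (t₀ := x0) (f := fun t => (lam * f t, lam * P t))
      (g := fun t => (G t, (1 - (t:ℂ)^2) * G1 t)) ?_ (abs_lt.mp hr0) ?_ ?_ ?_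
    · have := key (abs_lt.mp hrx)
      exact congrArg Prod.fst this
    · intro t ht
      have ht2 : t^2 ≤ r^2 := by have := ht.1; have := ht.2; nlinarith
      refine LipschitzWith.lipschitzOnWith (LipschitzWith.of_dist_le_mul fun y z => ?_)
      rw [dist_eq_norm, dist_eq_norm, hKv]
      have e : v t y - v t z = ((y - z).2 / (1 - (t:ℂ)^2), ((c:ℂ)^2 * (t:ℂ)^2 - χ) * (y - z).1) := by
        simp only [v]
        ext <;> simp <;> ring
      rw [e]
      refine (Prod.norm_def _).trans_le (max_le ?_ ?_)
      · simp only [norm_div]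
        have h1 : ‖(1 - (t:ℂ)^2)‖ = 1 - t^2 := by
          rw [show (1 - (t:ℂ)^2) = ((1 - t^2 : ℝ) : ℂ) by push_cast; ring, Complex.norm_real,
            Real.norm_of_nonneg (by linarith)]
        rw [h1, div_eq_mul_one_div, mul_comm]
        gcongr
        · have : 1 / (1 - t^2) ≤ 1 / (1 - r^2) := by gcongr
          have : 0 ≤ |χ| := abs_nonneg _
          nlinarith [sq_nonneg c]
        · exact norm_snd_le _
      · simp only [norm_mul]
        gcongr
        · rw [show ((c:ℂ)^2 * (t:ℂ)^2 - χ) = ((c^2 * t^2 - χ : ℝ) : ℂ) by push_cast; ring,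
            Complex.norm_real, Real.norm_eq_abs]
          have h1 : |c^2 * t^2 - χ| ≤ |c^2 * t^2| + |χ| := abs_sub _ _
          rw [abs_of_nonneg (by positivity : 0 ≤ c^2 * t^2)] at h1
          have : c^2 * t^2 ≤ c^2 * 1 := by gcongr; nlinarith
          have : 0 ≤ 1 / (1 - r^2) := by positivity
          linarith
        · exact norm_fst_le _
    · intro t ht
      refine ⟨?_, mem_univ _⟩
      have ht' := hsub t ht
      refine (((hfC t ht').const_mul lam).prodMk ((hPC t).const_mul lam)).congr_deriv ?_
      simp only [v]
      rw [← hPeqC t ht']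
      have := hne1 t ht'
      ext1
      · field_simp
      · ring
    · intro t ht
      refine ⟨?_, mem_univ _⟩
      have ht' := hsub t ht
      refine ((hGd t).prodMk (hQd t)).congr_deriv ?_
      simp only [v]
      have := hne1 t ht'
      ext1
      · field_simp
      · rfl
    · ext1
      · exact hGx0.symm
      · exact hQx0.symm
  refine ⟨lam, ?_, ?_⟩
  · intro h0
    apply hne
    apply aux_inj c hc f hf
    intro x hx
    have := hIoo x hx
    rw [h0, zero_mul] at this
    exact this.symm
  · have : EqOn (fun x => lam * (f x : ℂ)) G (closure (Ioo (-1:ℝ) 1)) :=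
      Set.EqOn.closure (fun x hx => hIoo x hx) (by fun_prop) hGc
    rw [closure_Ioo (by norm_num)] at this
    exact this

theorem continuous_ode_solution_is_integral_eigenfunction
    (c : ℝ) (hc : 0 < c)
    (χ : ℝ) (ψ : ℝ → ℝ)
    (hcont : ContinuousOn ψ (Set.Icc (-1:ℝ) 1))
    (hne : ¬ (∀ x ∈ Set.Icc (-1:ℝ) 1, ψ x = 0))
    (hC2 : ContDiffOn ℝ 2 ψ (Set.Ioo (-1:ℝ) 1))
    (hode : ∀ x ∈ Set.Ioo (-1:ℝ) 1,
      (1 - x^2) * deriv (deriv ψ) x - 2*x * deriv ψ x + (χ - c^2 * x^2) * ψ x = 0) :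
    ∃ lam : ℂ, lam ≠ 0 ∧ ∀ x ∈ Set.Icc (-1:ℝ) 1,
      lam * (ψ x : ℂ) =
        ∫ t in (-1:ℝ)..1, (ψ t : ℂ) * Complex.exp (Complex.I * (c:ℂ) * (x:ℂ) * (t:ℂ)) := by
  have h11 : (-1:ℝ) ≤ 1 := by norm_num
  set f : ℝ → ℝ := IccExtend h11 ((Icc (-1:ℝ) 1).domRestrict ψ) with hfdef
  have hf : Continuous f := (continuousOn_iff_continuous_domRestrict.mp hcont).Icc_extend'
  have hfeq : ∀ x ∈ Icc (-1:ℝ) 1, f x = ψ x := fun x hx => by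
    rw [hfdef, IccExtend_of_mem h11 _ hx]; rfl
  have hψd : ∀ x ∈ Ioo (-1:ℝ) 1, HasDerivAt ψ (deriv ψ x) x := fun x hx =>
    ((hC2.differentiableOn (by norm_num)).differentiableAt (isOpen_Ioo.mem_nhds hx)).hasDerivAt
  have hψ2 : ContDiffOn ℝ 1 (deriv ψ) (Ioo (-1:ℝ) 1) :=
    hC2.deriv_of_isOpen isOpen_Ioo (by norm_num)
  have hψd2 : ∀ x ∈ Ioo (-1:ℝ) 1, HasDerivAt (deriv ψ) (deriv (deriv ψ) x) x := fun x hx =>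
    ((hψ2.differentiableOn (by norm_num)).differentiableAt (isOpen_Ioo.mem_nhds hx)).hasDerivAt
  obtain ⟨lam, hl, h⟩ := aux_main c hc χ f (deriv ψ) hf
    (fun h => hne fun x hx => (hfeq x hx).symm.trans (h x hx))
    (fun x hx => (hψd x hx).congr_of_eventuallyEq (by
      filter_upwards [isOpen_Ioo.mem_nhds hx] with y hy using hfeq y ⟨hy.1.le, hy.2.le⟩))
    (fun x hx => by
      have h1 : HasDerivAt (fun x : ℝ => 1 - x^2) (-(2 * x)) x := by
        simpa using ((hasDerivAt_id x).pow 2).const_sub (1:ℝ)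
      refine (h1.mul (hψd2 x hx)).congr_deriv ?_
      rw [hfeq x ⟨hx.1.le, hx.2.le⟩]
      linear_combination hode x hx)
  refine ⟨lam, hl, fun x hx => ?_⟩
  rw [← hfeq x hx, h x hx]
  apply intervalIntegral.integral_congr
  intro t ht
  rw [uIcc_of_le h11] at ht
  simp only [hfeq t ht]
end
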